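/- Let D be a domain in ℂⁿ, let a₁,…,a_m : D → ℂ be continuous, write P(z,w) = wᵐ + a₁(z)w^{m−1} + ⋯ + a_m(z), and let B = {z ∈ D : P(z,·) has a root of multiplicity m}. Assume a₁,…,a_m are holomorphic on D ∖ B and that B is not pluripolar in ℂⁿ. Then a₂(z) = ((m−1)/(2m))·a₁(z)² for all z ∈ D. -/

import Mathlib

open Metric Set Polynomial

noncomputable section

/-- A function `u : ℂ → EReal` is subharmonic on an open set `U` if it is upper
semicontinuous on `U` and satisfies the maximum principle with respect to harmonic
majorants of the form `Re p`, `p` a complex polynomial, on every closed disc in `U`. -/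
def SubharmonicOn (u : ℂ → EReal) (U : Set ℂ) : Prop :=
  UpperSemicontinuousOn u U ∧
    ∀ (c : ℂ) (r : ℝ), 0 < r → closedBall c r ⊆ U →
      ∀ p : Polynomial ℂ,
        (∀ z ∈ sphere c r, u z ≤ (((p.eval z).re : ℝ) : EReal)) →
        ∀ z ∈ closedBall c r, u z ≤ (((p.eval z).re : ℝ) : EReal)

/-- `u : ℂ^N → [-∞, ∞)` is plurisubharmonic if it is upper semicontinuous, takes values
in `[-∞, ∞)`, and its restriction to every complex affine line is subharmonic. -/
def Plurisubharmonic {N : ℕ} (u : (Fin N → ℂ) → EReal) : Prop :=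
  UpperSemicontinuous u ∧ (∀ z, u z ≠ ⊤) ∧
    ∀ a b : Fin N → ℂ, SubharmonicOn (fun t : ℂ => u (a + t • b)) Set.univ

/-- A set `E ⊆ ℂ^N` is pluripolar if there is a plurisubharmonic function on `ℂ^N`,
not identically `-∞`, which is `-∞` on `E`. -/
def Pluripolar {N : ℕ} (E : Set (Fin N → ℂ)) : Prop :=
  ∃ u : (Fin N → ℂ) → EReal,
    Plurisubharmonic u ∧ ¬ (∀ z, u z = ⊥) ∧ ∀ z ∈ E, u z = ⊥


open scoped Topology


lemma trig_approx (φ : ℂ → ℝ) (hφ : ContinuousOn φ (sphere 0 1)) (ε : ℝ) (hε : 0 < ε) :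
    ∃ A : ℂ[X], ∀ z ∈ sphere (0:ℂ) 1, |φ z - (A.eval z).re| ≤ ε := by
  have : Fact ((0:ℝ) < 2 * Real.pi) := ⟨by positivity⟩
  let g : C(AddCircle (2 * Real.pi), ℂ) :=
    ⟨fun x => ((φ (AddCircle.toCircle x : ℂ) : ℝ) : ℂ), by
      refine Complex.continuous_ofReal.comp ?_
      refine hφ.comp_continuous (continuous_induced_dom.comp AddCircle.continuous_toCircle) ?_
      intro x; rw [mem_sphere_zero_iff_norm]; exact Circle.norm_coe _⟩
  have hg : g ∈ (Submodule.span ℂ (range <| @fourier (2 * Real.pi))).topologicalClosure := by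
    rw [span_fourier_closure_eq_top]; trivial
  have hg' : g ∈ closure ((Submodule.span ℂ (range <| @fourier (2 * Real.pi)) : Submodule ℂ _) : Set C(AddCircle (2 * Real.pi), ℂ)) := hg
  obtain ⟨s, hs, hsd⟩ := Metric.mem_closure_iff.1 hg' ε hε
  have key : ∀ c : ℂ, ∃ A : ℂ[X], ∀ x, (c * s x).re = (A.eval (AddCircle.toCircle x : ℂ)).re := by
    refine Submodule.span_induction (p := fun s _ => ∀ c : ℂ, ∃ A : ℂ[X], ∀ x, (c * s x).re = (A.eval (AddCircle.toCircle x : ℂ)).re) ?_ ?_ ?_ ?_ hs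
    · rintro _ ⟨n, rfl⟩ c
      rcases le_total 0 n with h | h
      · lift n to ℕ using h
        refine ⟨C c * X ^ n, fun x => ?_⟩
        simp [fourier_apply, AddCircle.toCircle_nsmul]
      · obtain ⟨k, rfl⟩ : ∃ k : ℕ, n = -k := ⟨n.natAbs, by omega⟩
        refine ⟨C (starRingEnd ℂ c) * X ^ k, fun x => ?_⟩
        have : (fourier (-(k:ℤ)) x : ℂ) = starRingEnd ℂ (fourier (k:ℤ) x) := by
          rw [fourier_neg]
        rw [this]
        have h2 : (fourier (k:ℤ) x : ℂ) = (AddCircle.toCircle x : ℂ)^k := by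
          simp [fourier_apply, AddCircle.toCircle_nsmul]
        rw [h2]
        simp only [eval_mul, eval_C, eval_pow, eval_X]
        rw [← Complex.conj_re, map_mul, Complex.conj_conj]
    · intro c; exact ⟨0, by simp⟩
    · intro x y _ _ hx hy c
      obtain ⟨A, hA⟩ := hx c
      obtain ⟨B, hB⟩ := hy c
      exact ⟨A + B, fun t => by simp only [ContinuousMap.add_apply, mul_add, eval_add, Complex.add_re, hA, hB]⟩
    · intro a x _ hx c
      obtain ⟨A, hA⟩ := hx (c * a)
      exact ⟨A, fun t => by rw [← hA]; simp [mul_assoc]⟩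
  obtain ⟨A, hA⟩ := key 1
  refine ⟨A, fun z hz => ?_⟩
  obtain ⟨x, hx⟩ : ∃ x : AddCircle (2 * Real.pi), (AddCircle.toCircle x : ℂ) = z := by
    obtain ⟨x, hx⟩ := (AddCircle.homeomorphCircle (T := 2 * Real.pi) (by positivity)).surjective (⟨z, hz⟩ : Circle)
    rw [AddCircle.homeomorphCircle_apply] at hx
    exact ⟨x, by rw [hx]⟩
  have h1 : dist (g x) (s x) < ε := (ContinuousMap.dist_apply_le_dist x).trans_lt hsd
  have h2 := Complex.abs_re_le_norm (g x - s x)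
  rw [← dist_eq_norm] at h2
  have h3 := hA x
  rw [one_mul] at h3
  rw [← hx, ← h3]
  have : (g x).re = φ (AddCircle.toCircle x : ℂ) := by simp [g]
  rw [← this, ← Complex.sub_re]
  linarith


/-- Radó's maximum principle step. -/
lemma rado_max {f g : ℂ → ℂ} (hf : ContinuousOn f (closedBall 0 1)) (hg : ContinuousOn g (closedBall 0 1))
    (hfd : ∀ z ∈ ball (0:ℂ) 1, f z ≠ 0 → DifferentiableAt ℂ f z)
    (hgd : ∀ z ∈ ball (0:ℂ) 1, f z ≠ 0 → DifferentiableAt ℂ g z)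
    (δ : ℝ) (hb : ∀ z ∈ sphere (0:ℂ) 1, (g z).re ≤ δ) {w : ℂ} (hw : w ∈ ball (0:ℂ) 1) (hfw : f w ≠ 0) :
    (g w).re ≤ δ := by
  obtain ⟨M, hM⟩ := (isCompact_closedBall (0:ℂ) 1).exists_bound_of_continuousOn hf
  set Ω : Set ℂ := {z ∈ ball (0:ℂ) 1 | f z ≠ 0} with hΩ
  have hΩo : IsOpen Ω := (hf.mono ball_subset_closedBall).isOpen_inter_preimage isOpen_ball isOpen_ne
  have hcl : closure Ω ⊆ closedBall 0 1 :=
    closure_minimal (fun z hz => ball_subset_closedBall hz.1) isClosed_closedBall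
  have hM0 : 0 ≤ M := (norm_nonneg _).trans (hM w (ball_subset_closedBall hw))
  have main : ∀ N : ℕ, ‖f w‖ * Real.exp (N * (g w).re) ≤ M * Real.exp (N * δ) := by
    intro N
    have hd : DiffContOnCl ℂ (fun z => f z * Complex.exp (N * g z)) Ω := by
      refine ⟨fun z hz => ?_, ?_⟩
      · have h1 := hfd z hz.1 hz.2
        have h2 := hgd z hz.1 hz.2
        exact (h1.mul ((h2.const_mul _).cexp)).differentiableWithinAt
      · exact (hf.mono hcl).mul ((continuousOn_const.mul (hg.mono hcl)).cexp)
    have hnorm : ∀ z, ‖f z * Complex.exp (N * g z)‖ = ‖f z‖ * Real.exp (N * (g z).re) := by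
      intro z; rw [norm_mul, Complex.norm_exp]; simp
    have := Complex.norm_le_of_forall_mem_frontier_norm_le (isBounded_ball.subset (fun z hz => hz.1)) hd
      (C := M * Real.exp (N * δ)) ?_ (subset_closure (⟨hw, hfw⟩ : w ∈ Ω))
    · rwa [hnorm] at this
    · intro z hz
      rw [hnorm]
      have hzc := hcl hz.1
      by_cases h0 : f z = 0
      · rw [h0]; simp; positivity
      · have hzs : z ∈ sphere (0:ℂ) 1 := by
          rw [hΩo.frontier_eq] at hz
          by_contra hne
          have : z ∈ ball (0:ℂ) 1 := by
            rw [mem_closedBall] at hzc; rw [mem_sphere] at hne; rw [mem_ball]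
            exact lt_of_le_of_ne hzc hne
          exact hz.2 ⟨this, h0⟩
        have h1 := hM z hzc
        have h2 := hb z hzs
        gcongr
  by_contra hlt
  push Not at hlt
  have hfp : 0 < ‖f w‖ := norm_pos_iff.2 hfw
  have h2 : ∀ N : ℕ, (1 + N * ((g w).re - δ)) ≤ M / ‖f w‖ := by
    intro N
    have h := main N
    have h3 : Real.exp (N * ((g w).re - δ)) ≤ M / ‖f w‖ := by
      rw [le_div_iff₀ hfp, mul_sub, Real.exp_sub, div_mul_eq_mul_div, div_le_iff₀ (Real.exp_pos _)]
      linarith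
    have := Real.add_one_le_exp (N * ((g w).re - δ))
    linarith
  obtain ⟨N, hN⟩ := exists_nat_gt ((M / ‖f w‖) / ((g w).re - δ))
  have h3 := h2 N
  rw [div_lt_iff₀ (by linarith)] at hN
  linarith

lemma rado_poisson
    {f g : ℂ → ℂ} (hf : ContinuousOn f (closedBall 0 1)) (hg : ContinuousOn g (closedBall 0 1))
    (hfd : ∀ z ∈ ball (0:ℂ) 1, f z ≠ 0 → DifferentiableAt ℂ f z)
    (hgd : ∀ z ∈ ball (0:ℂ) 1, f z ≠ 0 → DifferentiableAt ℂ g z)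
    {w : ℂ} (hw : w ∈ ball (0:ℂ) 1) (hfw : f w ≠ 0) :
    (g w).re = Real.circleAverage (poissonKernel 0 w • (fun z => (g z).re)) 0 1 := by
  have hgs : ContinuousOn (fun z => (g z).re) (sphere 0 1) :=
    Complex.continuous_re.comp_continuousOn (hg.mono sphere_subset_closedBall)
  have hPc : ContinuousOn (poissonKernel 0 w) (sphere 0 |1|) := by
    rw [poissonKernel_eq_re_herglotzRieszKernel]
    exact Complex.continuous_re.comp_continuousOn (continuousOn_herglotzRieszKernel_sphere hw)
  have hPnn : ∀ z ∈ sphere (0:ℂ) |1|, 0 ≤ poissonKernel 0 w z := by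
    intro z hz
    rw [poissonKernel_def]
    have : ‖z‖ = 1 := by simpa using hz
    have h2 : ‖w‖ < 1 := by simpa using hw
    simp only [sub_zero, this]
    apply div_nonneg _ (by positivity)
    nlinarith [norm_nonneg w]
  have hgs' : ContinuousOn (fun z => (g z).re) (sphere 0 |1|) := by simpa using hgs
  have hP1 : Real.circleAverage (poissonKernel 0 w) 0 1 = 1 := by
    have := (diffContOnCl_const (𝕜 := ℂ) (c := (1:ℂ)) (s := ball (0:ℂ) 1)).circleAverage_poissonKernel_smul hw
    have h2 := Complex.reCLM.circleAverage_comp_comm (f := (poissonKernel 0 w • fun _ => (1:ℂ))) (c := 0) (R := 1) ?_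
    · rw [this] at h2
      simp at h2
      rw [← h2]
      congr 1
      ext z
      simp
    · exact (hPc.smul continuousOn_const).circleIntegrable'
  have hre : ∀ A : ℂ[X], Real.circleAverage (poissonKernel 0 w • (fun z => (A.eval z).re)) 0 1 = (A.eval w).re := by
    intro A
    have := (A.differentiable (𝕜 := ℂ)).diffContOnCl (s := ball (0:ℂ) 1) |>.circleAverage_poissonKernel_smul hw
    have h2 := Complex.reCLM.circleAverage_comp_comm (f := (poissonKernel 0 w • fun z => A.eval z)) (c := 0) (R := 1) ?_
    · rw [this] at h2
      simp only [Complex.reCLM_apply] at h2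
      rw [← h2]
      congr 1
      ext z
      simp
    · exact (hPc.smul A.continuous.continuousOn).circleIntegrable'
  apply eq_of_forall_dist_le
  intro ε hε
  obtain ⟨A, hA⟩ := trig_approx _ hgs (ε/2) (by positivity)
  have e1 : |(g w).re - (A.eval w).re| ≤ ε/2 := by
    have hAd := A.differentiable (𝕜 := ℂ)
    have hAc := A.continuous (R := ℂ)
    rw [abs_le]
    constructor
    · have := rado_max (g := fun z => A.eval z - g z) hf (hAc.continuousOn.sub hg) hfd
        (fun z hz h => (hAd z).sub (hgd z hz h)) (ε/2) (fun z hz => by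
          have := abs_le.1 (hA z hz); simp only [Complex.sub_re]; linarith) hw hfw
      simp only [Complex.sub_re] at this; linarith
    · have := rado_max (g := fun z => g z - A.eval z) hf (hg.sub hAc.continuousOn) hfd
        (fun z hz h => (hgd z hz h).sub (hAd z)) (ε/2) (fun z hz => by
          have := abs_le.1 (hA z hz); simp only [Complex.sub_re]; linarith) hw hfw
      simp only [Complex.sub_re] at this; linarith
  have i1 : CircleIntegrable (poissonKernel 0 w • (fun z => (g z).re)) 0 1 := (hPc.smul hgs').circleIntegrable'
  have i2 : CircleIntegrable (poissonKernel 0 w • (fun z => (A.eval z).re)) 0 1 :=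
    (hPc.smul (Complex.continuous_re.comp A.continuous).continuousOn).circleIntegrable'
  have i3 : CircleIntegrable ((ε/2) • poissonKernel 0 w) 0 1 := (hPc.const_smul _).circleIntegrable'
  have i4 : Real.circleAverage ((ε/2) • poissonKernel 0 w) 0 1 = ε/2 := by
    rw [Real.circleAverage_smul, hP1]; simp
  have e2 := Real.circleAverage_mono i1 (i2.add i3) (fun z hz => by
    have h1 := hPnn z hz
    have h2 := abs_le.1 (hA z (by simpa using hz))
    simp only [Pi.smul_apply', Pi.add_apply, Pi.smul_apply, smul_eq_mul, Pi.mul_apply]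
    nlinarith)
  have e3 := Real.circleAverage_mono i2 (i1.add i3) (fun z hz => by
    have h1 := hPnn z hz
    have h2 := abs_le.1 (hA z (by simpa using hz))
    simp only [Pi.smul_apply', Pi.add_apply, Pi.smul_apply, smul_eq_mul, Pi.mul_apply]
    nlinarith)
  rw [Real.circleAverage_add i2 i3, hre, i4] at e2
  rw [Real.circleAverage_add i1 i3, hre, i4] at e3
  rw [Real.dist_eq]
  have := abs_le.1 e1
  rw [abs_le]; constructor <;> linarith

lemma deriv_zero_of_re_zero {f : ℂ → ℂ} {w : ℂ} (h : DifferentiableAt ℂ f w)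
    (hz : ∀ᶠ z in 𝓝 w, (f z).re = 0) : deriv f w = 0 := by
  have h1 := (Complex.reCLM.hasFDerivAt (x := f w)).comp w (h.hasDerivAt.hasFDerivAt.restrictScalars ℝ)
  have h2 : HasFDerivAt (Complex.reCLM ∘ f) (0 : ℂ →L[ℝ] ℝ) w := by
    refine (hasFDerivAt_const (0:ℝ) w).congr_of_eventuallyEq ?_
    filter_upwards [hz] with z hz
    simpa using hz
  have h3 := h1.unique h2
  have a1 := congrArg (fun L => L 1) h3
  have a2 := congrArg (fun L => L Complex.I) h3
  simp at a1 a2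
  exact Complex.ext (by simpa using a1) (by simpa using a2)

lemma rado_disc {f : ℂ → ℂ} (hf : ContinuousOn f (closedBall 0 1))
    (hfd : ∀ z ∈ ball (0:ℂ) 1, f z ≠ 0 → DifferentiableAt ℂ f z) :
    ∃ G : ℂ → ℂ, DifferentiableOn ℂ G (ball 0 1) ∧ ∀ w ∈ ball (0:ℂ) 1, f w ≠ 0 → f w = G w := by
  by_cases hne : ∃ w ∈ ball (0:ℂ) 1, f w ≠ 0
  swap
  · push Not at hne
    exact ⟨0, differentiableOn_const _, fun w hw h => absurd (hne w hw) h⟩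
  have hI : ContinuousOn (fun z => -Complex.I * f z) (closedBall 0 1) := continuousOn_const.mul hf
  let H : (ℂ → ℂ) → ℂ → ℂ := fun g w => Real.circleAverage (fun ζ ↦ herglotzRieszKernel 0 w ζ • (((g ζ).re : ℝ) : ℂ)) 0 1
  have hHd : ∀ g : ℂ → ℂ, ContinuousOn g (closedBall 0 1) → DifferentiableOn ℂ (H g) (ball 0 1) := by
    intro g hg
    refine differentiableOn_circleAverage_herglotzRieszKernel_smul ?_
    apply ContinuousOn.circleIntegrable'
    refine (Complex.continuous_ofReal.comp Complex.continuous_re).comp_continuousOn (hg.mono ?_)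
    simpa using sphere_subset_closedBall
  have hHre : ∀ g : ℂ → ℂ, ContinuousOn g (closedBall 0 1) →
      (∀ z ∈ ball (0:ℂ) 1, f z ≠ 0 → DifferentiableAt ℂ g z) → ∀ w ∈ ball (0:ℂ) 1, f w ≠ 0 →
      (g w).re = (H g w).re := by
    intro g hg hgd w hw hfw
    rw [rado_poisson hf hg hfd hgd hw hfw]
    simp only [H]
    rw [re_circleAverage_herglotzRieszKernel_smul _ hw, poissonKernel_eq_re_herglotzRieszKernel]
    apply ContinuousOn.circleIntegrable'
    refine (Complex.continuous_re).comp_continuousOn (hg.mono ?_)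
    simpa using sphere_subset_closedBall
  have hΩo : IsOpen {z ∈ ball (0:ℂ) 1 | f z ≠ 0} := (hf.mono ball_subset_closedBall).isOpen_inter_preimage isOpen_ball isOpen_ne
  have hId : ∀ z ∈ ball (0:ℂ) 1, f z ≠ 0 → DifferentiableAt ℂ (fun z => -Complex.I * f z) z :=
    fun z hz h => (hfd z hz h).const_mul _
  set G1 := H f
  set G2 := H (fun z => -Complex.I * f z)
  have hG1 : DifferentiableOn ℂ G1 (ball 0 1) := hHd _ hf
  have hG2 : DifferentiableOn ℂ G2 (ball 0 1) := hHd _ hI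
  have r1 : ∀ w ∈ ball (0:ℂ) 1, f w ≠ 0 → (f w).re = (G1 w).re := hHre f hf hfd
  have r2 : ∀ w ∈ ball (0:ℂ) 1, f w ≠ 0 → (f w).im = (G2 w).re := by
    intro w hw h
    have := hHre _ hI hId w hw h
    have e : (-Complex.I * f w).re = (f w).im := by simp
    rw [← e]
    exact this
  have hK : DifferentiableOn ℂ (fun z => G1 z - Complex.I * G2 z) (ball 0 1) :=
    hG1.sub (hG2.const_mul _)
  have hdK : ∀ w ∈ ball (0:ℂ) 1, f w ≠ 0 → deriv (fun z => G1 z - Complex.I * G2 z) w = 0 := by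
    intro w hw hfw
    have hnb : ball (0:ℂ) 1 ∈ 𝓝 w := isOpen_ball.mem_nhds hw
    have d1 := hG1.differentiableAt hnb
    have d2 := hG2.differentiableAt hnb
    have df := hfd w hw hfw
    have hev : ∀ᶠ z in 𝓝 w, z ∈ ball (0:ℂ) 1 ∧ f z ≠ 0 := hΩo.mem_nhds ⟨hw, hfw⟩
    have e1 := deriv_zero_of_re_zero (f := fun z => f z - G1 z) (df.sub d1) (by
      filter_upwards [hev] with z hz
      simp [r1 z hz.1 hz.2])
    have e2 := deriv_zero_of_re_zero (f := fun z => -Complex.I * f z - G2 z) ((df.const_mul _).sub d2) (by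
      filter_upwards [hev] with z hz
      simp [r2 z hz.1 hz.2])
    rw [deriv_fun_sub df d1] at e1
    rw [deriv_fun_sub (df.const_mul _) d2, deriv_const_mul _ df] at e2
    rw [deriv_fun_sub d1 (d2.const_mul _), deriv_const_mul _ d2]
    linear_combination (-1) * e1 + Complex.I * e2 + deriv f w * Complex.I_mul_I
  obtain ⟨w0, hw0, hfw0⟩ := hne
  have hKa := (hK.analyticOnNhd isOpen_ball).deriv
  have hz : EqOn (deriv (fun z => G1 z - Complex.I * G2 z)) 0 (ball 0 1) := by
    refine hKa.eqOn_zero_of_preconnected_of_eventuallyEq_zero isPreconnected_ball hw0 ?_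
    filter_upwards [hΩo.mem_nhds ⟨hw0, hfw0⟩] with z hz
    exact hdK z hz.1 hz.2
  obtain ⟨κ, hκ⟩ := isOpen_ball.exists_is_const_of_deriv_eq_zero isPreconnected_ball hK hz
  refine ⟨fun z => G1 z - Complex.I * (κ.im : ℂ), hG1.sub (differentiableOn_const _), fun w hw hfw => ?_⟩
  have := hκ w hw
  have him := congrArg Complex.im this
  apply Complex.ext
  · simp [r1 w hw hfw]
  · simp [r2 w hw hfw]
    simp at him
    linarith

lemma isPreconnected_punctured_ball (ρ : ℝ) (hρ : 0 < ρ) : IsPreconnected (ball (0:ℂ) ρ \ {0}) := by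
  have : ball (0:ℂ) ρ \ {0} = Complex.exp '' {z | z.re < Real.log ρ} := by
    ext z
    simp only [mem_sdiff, mem_ball, dist_zero_right, mem_singleton_iff, mem_image, mem_ofPred_eq]
    constructor
    · rintro ⟨h1, h2⟩
      refine ⟨Complex.log z, ?_, Complex.exp_log h2⟩
      rw [Complex.log_re]
      exact Real.log_lt_log (norm_pos_iff.2 h2) h1
    · rintro ⟨w, hw, rfl⟩
      refine ⟨?_, Complex.exp_ne_zero _⟩
      rw [Complex.norm_exp]
      exact (Real.lt_log_iff_exp_lt hρ).1 hw
  rw [this]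
  exact (convex_halfSpace_re_lt _).isPreconnected.image _ Complex.continuous_exp.continuousOn

lemma rado_zero {f : ℂ → ℂ} (hf : ContinuousOn f (closedBall 0 1))
    (hfd : ∀ z ∈ ball (0:ℂ) 1, f z ≠ 0 → DifferentiableAt ℂ f z) : DifferentiableAt ℂ f 0 := by
  have h0 : (0:ℂ) ∈ ball (0:ℂ) 1 := by simp
  by_cases hf0 : f 0 = 0
  swap
  · exact hfd 0 h0 hf0
  by_cases hev : ∀ᶠ z in 𝓝 (0:ℂ), f z = 0
  · exact (differentiableAt_const (0:ℂ)).congr_of_eventuallyEq hev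
  obtain ⟨G, hG, hfG⟩ := rado_disc hf hfd
  have hfc : ContinuousOn f (ball 0 1) := hf.mono ball_subset_closedBall
  have hΩo : IsOpen {z ∈ ball (0:ℂ) 1 | f z ≠ 0} := hfc.isOpen_inter_preimage isOpen_ball isOpen_ne
  -- equality on the closure
  have hcl : ∀ z ∈ ball (0:ℂ) 1, z ∈ closure {z ∈ ball (0:ℂ) 1 | f z ≠ 0} → f z = G z := by
    intro z hz hzc
    have hc : ContinuousAt (fun z => f z - G z) z :=
      ((hfc.sub hG.continuousOn)).continuousAt (isOpen_ball.mem_nhds hz)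
    by_contra hne
    have : ∀ᶠ y in 𝓝 z, f y - G y ≠ 0 := hc.eventually_ne (sub_ne_zero.2 hne)
    obtain ⟨y, hy1, hy2⟩ := ((mem_closure_iff_frequently.1 hzc).and_eventually this).exists
    exact hy2 (sub_eq_zero.2 (hfG y hy1.1 hy1.2))
  have hfreq : ∃ᶠ z in 𝓝 (0:ℂ), z ∈ {z ∈ ball (0:ℂ) 1 | f z ≠ 0} := by
    have h1 : ∃ᶠ z in 𝓝 (0:ℂ), f z ≠ 0 := Filter.not_eventually.1 hev
    exact (h1.and_eventually (isOpen_ball.mem_nhds h0)).mono (fun z hz => ⟨hz.2, hz.1⟩)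
  have hG0 : f 0 = G 0 := hcl 0 h0 (mem_closure_iff_frequently.2 hfreq)
  have hGa : AnalyticAt ℂ G 0 := hG.analyticAt (isOpen_ball.mem_nhds h0)
  rcases hGa.eventually_eq_zero_or_eventually_ne_zero with h | h
  · exfalso
    obtain ⟨y, hy1, hy2⟩ := (hfreq.and_eventually h).exists
    exact hy1.2 ((hfG y hy1.1 hy1.2).trans hy2)
  rw [eventually_nhdsWithin_iff] at h
  obtain ⟨ρ, hρ, hρG⟩ := Metric.eventually_nhds_iff_ball.1 (h.and (isOpen_ball.mem_nhds h0))
  have hP := isPreconnected_punctured_ball ρ hρ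
  have hsub : ball (0:ℂ) ρ \ {0} ⊆ {z ∈ ball (0:ℂ) 1 | f z ≠ 0} := by
    refine hP.subset_left_of_subset_union hΩo (isClosed_closure (s := {z ∈ ball (0:ℂ) 1 | f z ≠ 0})).isOpen_compl
      (disjoint_left.2 fun z hz hz2 => hz2 (subset_closure hz)) ?_ ?_
    · intro z hz
      by_cases hfz : f z = 0
      · right
        intro hzc
        have h1 := hcl z (hρG z hz.1).2 hzc
        exact (hρG z hz.1).1 hz.2 (h1.symm.trans hfz)
      · left; exact ⟨(hρG z hz.1).2, hfz⟩
    · obtain ⟨y, hy1, hy2⟩ := (hfreq.and_eventually (ball_mem_nhds _ hρ)).exists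
      refine ⟨y, ⟨hy2, ?_⟩, hy1⟩
      rintro rfl
      exact hy1.2 hf0
  refine hGa.differentiableAt.congr_of_eventuallyEq ?_
  filter_upwards [ball_mem_nhds _ hρ] with z hz
  by_cases hz0 : z = 0
  · rw [hz0, hG0]
  · have := hsub ⟨hz, hz0⟩
    exact hfG z this.1 this.2

theorem rado {f : ℂ → ℂ} {U : Set ℂ} (hU : IsOpen U) (hf : ContinuousOn f U)
    (hfd : ∀ z ∈ U, f z ≠ 0 → DifferentiableAt ℂ f z) : DifferentiableOn ℂ f U := by
  intro z hz
  obtain ⟨r, hr, hrU⟩ := Metric.nhds_basis_closedBall.mem_iff.1 (hU.mem_nhds hz)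
  have hm : ∀ t ∈ closedBall (0:ℂ) 1, z + r * t ∈ U := by
    intro t ht
    apply hrU
    simp only [mem_closedBall, dist_self_add_left, norm_mul, Complex.norm_real, Real.norm_eq_abs,
      abs_of_pos hr, dist_zero_right] at ht ⊢
    nlinarith
  have hc : ContinuousOn (fun t : ℂ => f (z + r * t)) (closedBall 0 1) :=
    hf.comp (by fun_prop) hm
  have := rado_zero hc (fun t ht h => by
    have := hfd _ (hm t (ball_subset_closedBall ht)) h
    exact DifferentiableAt.comp t this (by fun_prop))
  have h2 : DifferentiableAt ℂ ((fun t : ℂ => f (z + r * t)) ∘ (fun y => (y - z) / r)) z := by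
    apply DifferentiableAt.comp
    · simpa using this
    · fun_prop
  have h3 : ((fun t : ℂ => f (z + r * t)) ∘ (fun y => (y - z) / r)) = f := by
    ext y
    have : (r:ℂ) ≠ 0 := by exact_mod_cast hr.ne'
    simp only [Function.comp]
    congr 1
    field_simp
    ring
  rw [h3] at h2
  exact h2.differentiableWithinAt

section Osgood

variable {E : Type*} [NormedAddCommGroup E] [NormedSpace ℂ E]

/-- continuous and holomorphic along complex lines -/
def LineHol (f : E → ℂ) (D : Set E) : Prop :=
  ContinuousOn f D ∧ ∀ x v : E, DifferentiableOn ℂ (fun t : ℂ => f (x + t • v)) {t | x + t • v ∈ D}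

/-- directional derivative -/
def dirD (f : E → ℂ) (v : E) (x : E) : ℂ := deriv (fun t : ℂ => f (x + t • v)) 0

lemma LineHol.mono {f : E → ℂ} {D D' : Set E} (h : LineHol f D) (hD : D' ⊆ D) : LineHol f D' :=
  ⟨h.1.mono hD, fun x v => (h.2 x v).mono fun _ ht => hD ht⟩

lemma isOpen_slice {D : Set E} (hD : IsOpen D) (x v : E) : IsOpen {t : ℂ | x + t • v ∈ D} :=
  hD.preimage (by fun_prop)

lemma lineHol_of_local {f : E → ℂ} {D : Set E}
    (h : ∀ x ∈ D, ∃ U, IsOpen U ∧ x ∈ U ∧ LineHol f U) : LineHol f D := by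
  refine ⟨fun x hx => ?_, fun x v t ht => ?_⟩
  · obtain ⟨U, hU, hxU, h1⟩ := h x hx
    exact (h1.1.continuousAt (hU.mem_nhds hxU)).continuousWithinAt
  · obtain ⟨U, hU, hxU, h1⟩ := h _ ht
    exact ((h1.2 x v).differentiableAt ((isOpen_slice hU x v).mem_nhds hxU)).differentiableWithinAt

lemma second_order_est {φ : ℂ → ℂ} {r M : ℝ} (hr : 0 < r) (hφ : DifferentiableOn ℂ φ (ball 0 r))
    (hM : ∀ t ∈ ball (0:ℂ) r, ‖φ t‖ ≤ M) {t : ℂ} (ht : t ∈ ball (0:ℂ) r) :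
    ‖φ t - φ 0 - t * deriv φ 0‖ ≤ 4 * M * (‖t‖ / r) ^ 2 := by
  have h0 : (0:ℂ) ∈ ball (0:ℂ) r := by simpa
  have hd0 : DifferentiableAt ℂ φ 0 := hφ.differentiableAt (isOpen_ball.mem_nhds h0)
  have hder : ‖deriv φ 0‖ ≤ (2 * M) / r := by
    refine Complex.norm_deriv_le_div_of_mapsTo_ball hφ (fun s hs => ?_) hr
    rw [mem_closedBall, dist_eq_norm]
    have := norm_sub_le (φ s) (φ 0)
    linarith [hM s hs, hM 0 h0]
  have key := Complex.dist_le_mul_div_pow_of_mapsTo_ball_of_isLittleO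
    (f := fun s => φ s - φ 0 - s * deriv φ 0) (c := 0) (z := t) (R₁ := r) (R₂ := 4 * M) (n := 1)
    ?_ ?_ ?_ ht
  · simpa [dist_eq_norm] using key
  · exact (hφ.sub (differentiableOn_const _)).sub (differentiableOn_id.mul_const _)
  · intro s hs
    simp only [mem_closedBall, dist_eq_norm]
    have e1 := norm_sub_le (φ s) (φ 0)
    have e2 := norm_sub_le (φ s - φ 0) (s * deriv φ 0)
    have e3 : ‖s * deriv φ 0‖ ≤ 2 * M := by
      rw [norm_mul]
      have hs' : ‖s‖ ≤ r := (mem_ball_zero_iff.1 hs).le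
      calc ‖s‖ * ‖deriv φ 0‖ ≤ r * (2 * M / r) := by gcongr
        _ = 2 * M := by field_simp
    have e4 : φ s - φ 0 - s * deriv φ 0 - (φ 0 - φ 0 - 0 * deriv φ 0) = φ s - φ 0 - s * deriv φ 0 := by ring
    rw [e4]
    linarith [hM s hs, hM 0 h0]
  · have := hd0.hasDerivAt.isLittleO
    simp only [sub_zero, smul_eq_mul] at this
    simpa using this.norm_right

lemma exists_unif_ball {f : E → ℂ} {D : Set E} (hD : IsOpen D) (hf : ContinuousOn f D) {x : E} (hx : x ∈ D) :
    ∃ r > 0, ∃ M > 0, ball x r ⊆ D ∧ ∀ y ∈ ball x r, ‖f y‖ ≤ M := by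
  have hc := (hf.continuousAt (hD.mem_nhds hx)).norm
  have h1 : ∀ᶠ y in 𝓝 x, ‖f y‖ < ‖f x‖ + 1 := hc.eventually_lt_const (by linarith)
  obtain ⟨r, hr, h⟩ := Metric.eventually_nhds_iff_ball.1 (h1.and (hD.mem_nhds hx))
  exact ⟨r, hr, ‖f x‖ + 1, by positivity, fun y hy => (h y hy).2, fun y hy => (h y hy).1.le⟩

lemma LineHol.lineHol_dirD {f : E → ℂ} {D : Set E} (hD : IsOpen D) (hf : LineHol f D) (v : E) :
    LineHol (dirD f v) D := by
  refine lineHol_of_local fun x hx => ?_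
  obtain ⟨r, hr, M, hM, hrD, hfM⟩ := exists_unif_ball hD hf.1 hx
  set δ : ℝ := r / 2 / (‖v‖ + 1) with hδ
  have hδ0 : 0 < δ := by positivity
  have hin : ∀ y ∈ ball x (r/2), ∀ t ∈ ball (0:ℂ) δ, y + t • v ∈ ball x r := by
    intro y hy t ht
    rw [mem_ball, dist_eq_norm] at *
    have e1 : ‖t • v‖ ≤ δ * (‖v‖ + 1) := by
      rw [norm_smul]
      have : ‖t‖ ≤ δ := by simpa using ht.le
      gcongr; linarith
    have e2 : δ * (‖v‖ + 1) = r / 2 := by rw [hδ]; field_simp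
    calc ‖y + t • v - x‖ = ‖(y - x) + t • v‖ := by congr 1; abel
      _ ≤ ‖y - x‖ + ‖t • v‖ := norm_add_le _ _
      _ < r := by linarith
  -- sequence
  let s : ℕ → ℂ := fun k => ((δ / (k + 2) : ℝ) : ℂ)
  have hsn : ∀ k, ‖s k‖ = δ / (k + 2) := fun k => by
    simp only [s, Complex.norm_real, Real.norm_eq_abs]; exact abs_of_pos (by positivity)
  have hs0 : ∀ k, s k ≠ 0 := fun k => by
    rw [← norm_pos_iff, hsn]; positivity
  have hsb : ∀ k, s k ∈ ball (0:ℂ) δ := fun k => by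
    rw [mem_ball_zero_iff, hsn, div_lt_iff₀ (by positivity)]
    have : (0:ℝ) ≤ k := by positivity
    nlinarith
  let q : ℕ → E → ℂ := fun k y => (s k)⁻¹ * (f (y + s k • v) - f y)
  have hest : ∀ k, ∀ y ∈ ball x (r/2), ‖dirD f v y - q k y‖ ≤ 4 * M / δ ^ 2 * ‖s k‖ := by
    intro k y hy
    have hφ : DifferentiableOn ℂ (fun t : ℂ => f (y + t • v)) (ball 0 δ) :=
      (hf.2 y v).mono fun t ht => hrD (hin y hy t ht)
    have := second_order_est hδ0 hφ (M := M) (fun t ht => hfM _ (hin y hy t ht)) (hsb k)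
    have e : dirD f v y - q k y = -(s k)⁻¹ * (f (y + s k • v) - f (y + (0:ℂ) • v) - s k * deriv (fun t : ℂ => f (y + t • v)) 0) := by
      simp only [q, dirD]
      have := hs0 k
      rw [zero_smul, add_zero]
      field_simp
      ring
    rw [e, norm_mul, norm_neg, norm_inv]
    have hp : 0 < ‖s k‖ := norm_pos_iff.2 (hs0 k)
    calc ‖s k‖⁻¹ * _ ≤ ‖s k‖⁻¹ * (4 * M * (‖s k‖ / δ) ^ 2) := by gcongr
      _ = _ := by field_simp
  have hslim : Filter.Tendsto (fun k => 4 * M / δ ^ 2 * ‖s k‖) Filter.atTop (𝓝 0) := by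
    have : Filter.Tendsto (fun k : ℕ => δ / ((k:ℝ) + 2)) Filter.atTop (𝓝 0) :=
      Filter.Tendsto.div_atTop tendsto_const_nhds
        (Filter.tendsto_atTop_add_const_right _ _ tendsto_natCast_atTop_atTop)
    simp only [hsn]
    simpa using this.const_mul (4 * M / δ ^ 2)
  have hunif : TendstoUniformlyOn q (dirD f v) Filter.atTop (ball x (r/2)) := by
    rw [Metric.tendstoUniformlyOn_iff]
    intro ε hε
    filter_upwards [hslim.eventually_lt_const hε] with k hk y hy
    rw [dist_eq_norm]
    exact (hest k y hy).trans_lt hk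
  have hq : ∀ k, LineHol (q k) (ball x (r/2)) := by
    intro k
    have hsub : ball x (r/2) ⊆ D := (ball_subset_ball (by linarith)).trans hrD
    refine ⟨?_, fun y w => ?_⟩
    · refine continuousOn_const.mul (ContinuousOn.sub ?_ (hf.1.mono hsub))
      exact hf.1.comp (by fun_prop) (fun y hy => hrD (hin y hy _ (hsb k)))
    · refine DifferentiableOn.const_mul (DifferentiableOn.sub ?_ ((hf.2 y w).mono fun t ht => hsub ht)) _
      have := hf.2 (y + s k • v) w
      refine (this.mono (s := {t : ℂ | y + t • w ∈ ball x (r/2)}) ?_).congr ?_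
      · intro t ht
        have := hrD (hin _ ht _ (hsb k))
        rwa [add_right_comm] at this
      · intro t ht
        rw [add_right_comm]
  refine ⟨ball x (r/2), isOpen_ball, mem_ball_self (by positivity), ?_, fun y w => ?_⟩
  · exact hunif.continuousOn (Filter.Eventually.of_forall fun k => (hq k).1).frequently
  · have h2 : TendstoUniformlyOn (fun k (t:ℂ) => q k (y + t • w)) (fun t : ℂ => dirD f v (y + t • w)) Filter.atTop
        {t : ℂ | y + t • w ∈ ball x (r/2)} := hunif.comp (fun t : ℂ => y + t • w)
    exact h2.tendstoLocallyUniformlyOn.differentiableOn (Filter.Eventually.of_forall fun k => (hq k).2 y w)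
      (isOpen_slice isOpen_ball y w)

lemma LineHol.hasDerivAt {f : E → ℂ} {D : Set E} (hD : IsOpen D) (hf : LineHol f D) {x v : E} {t : ℂ}
    (h : x + t • v ∈ D) : HasDerivAt (fun t : ℂ => f (x + t • v)) (dirD f v (x + t • v)) t := by
  have h1 : DifferentiableAt ℂ (fun t : ℂ => f (x + t • v)) t :=
    (hf.2 x v).differentiableAt ((isOpen_slice hD x v).mem_nhds h)
  suffices e : dirD f v (x + t • v) = deriv (fun t : ℂ => f (x + t • v)) t by
    rw [e]; exact h1.hasDerivAt
  have : (fun s : ℂ => f (x + t • v + s • v)) = fun s => (fun t : ℂ => f (x + t • v)) (s + t) := by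
    ext s
    simp only
    congr 1
    rw [add_smul]; abel
  unfold dirD
  rw [this]
  have h5 := deriv_comp_add_const (fun t : ℂ => f (x + t • v)) t 0
  rw [zero_add] at h5
  exact h5

lemma LineHol.dirD_add {f : E → ℂ} {D : Set E} (hD : IsOpen D) (hf : LineHol f D) {x : E} (hx : x ∈ D)
    (v w : E) : dirD f (v + w) x = dirD f v x + dirD f w x := by
  let F : ℂ → ℂ → ℂ := fun s t => f (x + s • v + t • w)
  have hev : ∀ᶠ p : ℂ × ℂ in 𝓝 (0, 0), x + p.1 • v + p.2 • w ∈ D := by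
    have hc : ContinuousAt (fun p : ℂ × ℂ => x + p.1 • v + p.2 • w) (0,0) := by fun_prop
    exact hc.eventually_mem (hD.mem_nhds (by simpa using hx))
  have hcont : ∀ u, ContinuousAt (fun p : ℂ × ℂ => dirD f u (x + p.1 • v + p.2 • w)) (0,0) := by
    intro u
    have hc : ContinuousAt (fun p : ℂ × ℂ => x + p.1 • v + p.2 • w) (0,0) := by fun_prop
    refine ContinuousAt.comp (f := fun p : ℂ × ℂ => x + p.1 • v + p.2 • w) (g := dirD f u) ?_ hc
    refine (hf.lineHol_dirD hD u).1.continuousAt (hD.mem_nhds ?_)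
    simpa using hx
  have hclm : Continuous (fun c : ℂ => ContinuousLinearMap.toSpanSingleton ℂ c) := by
    have : (fun c : ℂ => ContinuousLinearMap.toSpanSingleton ℂ c) = fun c : ℂ => c • (1 : ℂ →L[ℂ] ℂ) := by
      ext c; simp
    rw [this]
    fun_prop
  have key := hasStrictFDerivAt_uncurry_coprod (𝕜 := ℂ) (u := ((0:ℂ),(0:ℂ))) (f := F)
    (f₁ := fun s t => ContinuousLinearMap.toSpanSingleton ℂ (dirD f v (x + s • v + t • w)))
    (f₂ := fun s t => ContinuousLinearMap.toSpanSingleton ℂ (dirD f w (x + s • v + t • w)))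
    (by
      filter_upwards [hev] with p hp
      have := hf.hasDerivAt hD (x := x + p.2 • w) (v := v) (t := p.1) (by rwa [add_right_comm])
      simp only [F]
      have e : (fun s : ℂ => f (x + s • v + p.2 • w)) = fun s : ℂ => f (x + p.2 • w + s • v) := by
        ext s; rw [add_right_comm]
      rw [e]
      simp only [Function.HasUncurry.uncurry, id]
      have e2 : x + p.1 • v + p.2 • w = x + p.2 • w + p.1 • v := by rw [add_right_comm]
      rw [e2]
      exact this.hasFDerivAt)
    (by
      filter_upwards [hev] with p hp
      exact (hf.hasDerivAt hD (x := x + p.1 • v) (v := w) (t := p.2) hp).hasFDerivAt)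
    (hclm.continuousAt.comp (hcont v)) (hclm.continuousAt.comp (hcont w))
  have hg : HasDerivAt (fun t : ℂ => (t, t)) ((1:ℂ),(1:ℂ)) 0 := (hasDerivAt_id 0).prodMk (hasDerivAt_id 0)
  have h3 := HasFDerivAt.comp_hasDerivAt (0:ℂ) (f := fun t : ℂ => (t, t)) key.hasFDerivAt hg
  have h4 := h3.deriv
  have e : ((fun p : ℂ × ℂ => F p.1 p.2) ∘ fun t : ℂ => (t, t)) = fun t : ℂ => f (x + t • (v + w)) := by
    ext t; simp [F, smul_add, add_assoc]
  have e' : (Function.HasUncurry.uncurry F ∘ fun t : ℂ => (t, t)) = fun t : ℂ => f (x + t • (v + w)) := e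
  rw [e'] at h4
  rw [dirD, h4]
  simp [Function.HasUncurry.uncurry]

lemma dirD_smul (f : E → ℂ) (c : ℂ) (v x : E) : dirD f (c • v) x = c * dirD f v x := by
  unfold dirD
  have : (fun t : ℂ => f (x + t • c • v)) = fun t => (fun t : ℂ => f (x + t • v)) (c * t) := by
    ext t; simp [smul_smul, mul_comm]
  rw [this]
  have h5 := deriv_comp_mul_left c (fun t : ℂ => f (x + t • v)) 0
  simpa using h5

variable [FiniteDimensional ℂ E]

lemma LineHol.exists_fderiv {f : E → ℂ} {D : Set E} (hD : IsOpen D) (hf : LineHol f D) {x : E} (hx : x ∈ D) :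
    ∃ L : E →L[ℂ] ℂ, (∀ v, L v = dirD f v x) ∧ HasFDerivAt f L x := by
  let L0 : E →ₗ[ℂ] ℂ :=
    { toFun := fun v => dirD f v x
      map_add' := hf.dirD_add hD hx
      map_smul' := fun c v => dirD_smul f c v x }
  refine ⟨LinearMap.toContinuousLinearMap L0, fun v => rfl, ?_⟩
  obtain ⟨r, hr, M, hM, hrD, hfM⟩ := exists_unif_ball hD hf.1 hx
  have hest : ∀ w ∈ ball (0:E) r, ‖f (x + w) - f x - L0 w‖ ≤ (4 * M / r ^ 2) * ‖w‖ ^ 2 := by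
    intro w hw
    rw [mem_ball_zero_iff] at hw
    by_cases hw0 : w = 0
    · simp [hw0]
    have hwp : 0 < ‖w‖ := norm_pos_iff.2 hw0
    have hin : ∀ t ∈ ball (0:ℂ) (r / ‖w‖), x + t • w ∈ ball x r := by
      intro t ht
      rw [mem_ball_zero_iff, lt_div_iff₀ hwp] at ht
      simpa [norm_smul] using ht
    have hφ : DifferentiableOn ℂ (fun t : ℂ => f (x + t • w)) (ball 0 (r / ‖w‖)) :=
      (hf.2 x w).mono fun t ht => hrD (hin t ht)
    have := second_order_est (r := r / ‖w‖) (by positivity) hφ (M := M) (fun t ht => hfM _ (hin t ht)) (t := 1)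
      (by simp [lt_div_iff₀ hwp, hw])
    simp only [one_smul, zero_smul, add_zero, one_mul, norm_one] at this
    calc _ ≤ _ := this
      _ = _ := by field_simp
  rw [hasFDerivAt_iff_isLittleO_nhds_zero]
  have hO : (fun w : E => f (x + w) - f x - (LinearMap.toContinuousLinearMap L0) w) =O[𝓝 0] (fun w => ‖w‖ ^ 2) := by
    refine Asymptotics.IsBigO.of_bound (4 * M / r ^ 2) ?_
    filter_upwards [ball_mem_nhds (0:E) hr] with w hw
    simpa using hest w hw
  refine hO.trans_isLittleO ?_
  have := Asymptotics.isLittleO_norm_pow_id (E' := E) (n := 2) (by norm_num)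
  exact this

lemma LineHol.contDiffOn_nat {D : Set E} (hD : IsOpen D) (N : ℕ) :
    ∀ {f : E → ℂ}, LineHol f D → ContDiffOn ℂ N f D := by
  induction N with
  | zero => intro f hf; exact contDiffOn_zero.2 hf.1
  | succ N ih =>
    intro f hf
    have h : ((N + 1 : ℕ) : WithTop ℕ∞) = N + 1 := by simp
    rw [h, contDiffOn_succ_iff_fderiv_of_isOpen hD]
    refine ⟨fun x hx => ?_, by simp, ?_⟩
    · obtain ⟨L, -, hL⟩ := hf.exists_fderiv hD hx
      exact hL.differentiableAt.differentiableWithinAt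
    · rw [contDiffOn_clm_apply]
      intro v
      refine (ih (hf.lineHol_dirD hD v)).congr ?_
      intro x hx
      obtain ⟨L, hLv, hL⟩ := hf.exists_fderiv hD hx
      rw [hL.fderiv, hLv]

lemma LineHol.contDiffOn {D : Set E} (hD : IsOpen D) {f : E → ℂ} (hf : LineHol f D) :
    ContDiffOn ℂ (⊤ : ℕ∞) f D :=
  contDiffOn_infty.2 fun N => hf.contDiffOn_nat hD N

end Osgood

section Strat

variable {E : Type*} [NormedAddCommGroup E] [NormedSpace ℂ E]

/-- iterated directional derivatives -/
def iterD : List E → (E → ℂ) → E → ℂ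
  | [], f => f
  | v :: l, f => dirD (iterD l f) v

lemma LineHol.iterD {f : E → ℂ} {D : Set E} (hD : IsOpen D) (hf : LineHol f D) (l : List E) :
    LineHol (iterD l f) D := by
  induction l with
  | nil => exact hf
  | cons v l ih => exact ih.lineHol_dirD hD v

lemma iterD_eventually_zero {f : E → ℂ} {x : E} (h : ∀ᶠ y in 𝓝 x, f y = 0) (l : List E) :
    ∀ᶠ y in 𝓝 x, iterD l f y = 0 := by
  induction l with
  | nil => exact h
  | cons v l ih =>
    filter_upwards [eventually_eventually_nhds.2 ih] with y hy
    have hc : Filter.Tendsto (fun t : ℂ => y + t • v) (𝓝 0) (𝓝 y) := by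
      have : ContinuousAt (fun t : ℂ => y + t • v) 0 := by fun_prop
      simpa [ContinuousAt] using this
    have h2 : (fun t : ℂ => iterD l f (y + t • v)) =ᶠ[𝓝 0] fun _ => (0:ℂ) := hc.eventually hy
    show deriv (fun t : ℂ => iterD l f (y + t • v)) 0 = 0
    rw [h2.deriv_eq, deriv_const]

lemma iterD_replicate {f : E → ℂ} {D : Set E} (hD : IsOpen D) (hf : LineHol f D) (x v : E) (k : ℕ) :
    ∀ t : ℂ, x + t • v ∈ D → iteratedDeriv k (fun t : ℂ => f (x + t • v)) t =
      iterD (List.replicate k v) f (x + t • v) := by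
  induction k with
  | zero => intro t _; simp [iterD]
  | succ k ih =>
    intro t ht
    rw [iteratedDeriv_succ]
    have h2 : iteratedDeriv k (fun t : ℂ => f (x + t • v)) =ᶠ[𝓝 t]
        fun t => iterD (List.replicate k v) f (x + t • v) := by
      filter_upwards [(isOpen_slice hD x v).mem_nhds ht] with s hs
      exact ih s hs
    rw [h2.deriv_eq]
    exact ((hf.iterD hD (List.replicate k v)).hasDerivAt hD ht).deriv

lemma eventually_zero_of_iterD {f : E → ℂ} {D : Set E} (hD : IsOpen D) (hf : LineHol f D) {x : E} (hx : x ∈ D)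
    (h : ∀ l, iterD l f x = 0) : ∀ᶠ y in 𝓝 x, f y = 0 := by
  obtain ⟨r, hr, hrD⟩ := Metric.isOpen_iff.1 hD x hx
  filter_upwards [ball_mem_nhds x hr] with y hy
  by_cases hyx : y = x
  · rw [hyx]; exact h []
  have hp : 0 < ‖y - x‖ := norm_pos_iff.2 (sub_ne_zero.2 hyx)
  have hin : ∀ t ∈ ball (0:ℂ) (r / ‖y - x‖), x + t • (y - x) ∈ D := by
    intro t ht
    apply hrD
    rw [mem_ball_zero_iff, lt_div_iff₀ hp] at ht
    simpa [norm_smul] using ht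
  have hφ : DifferentiableOn ℂ (fun t : ℂ => f (x + t • (y - x))) (ball 0 (r / ‖y - x‖)) :=
    (hf.2 x (y - x)).mono hin
  have h1 : (1:ℂ) ∈ ball (0:ℂ) (r / ‖y - x‖) := by
    rw [mem_ball_zero_iff, lt_div_iff₀ hp]
    simpa [dist_eq_norm] using hy
  have hs := Complex.hasSum_taylorSeries_on_ball hφ h1
  have : ∀ k, iteratedDeriv k (fun t : ℂ => f (x + t • (y - x))) 0 = 0 := by
    intro k
    rw [iterD_replicate hD hf x (y - x) k 0 (by simpa using hx)]
    simpa using h _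
  simp only [this, smul_zero] at hs
  have := hs.unique hasSum_zero
  simpa using this

lemma zero_of_eventually {f : E → ℂ} {D : Set E} (hD : IsOpen D) (hDc : IsPreconnected D) (hf : LineHol f D)
    {x : E} (hx : x ∈ D) (h : ∀ᶠ y in 𝓝 x, f y = 0) : ∀ y ∈ D, f y = 0 := by
  have hsub : D ⊆ {y | ∀ᶠ z in 𝓝 y, f z = 0} := by
    refine hDc.subset_left_of_subset_union (v := ⋃ l, {y ∈ D | iterD l f y ≠ 0}) ?_ ?_ ?_ ?_ ⟨x, hx, h⟩
    · exact isOpen_setOfPred_eventually_nhds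
    · exact isOpen_iUnion fun l => (hf.iterD hD l).1.isOpen_inter_preimage hD isOpen_ne
    · rw [disjoint_left]
      intro y hy hy2
      obtain ⟨l, hl⟩ := mem_iUnion.1 hy2
      exact hl.2 (iterD_eventually_zero hy l).self_of_nhds
    · intro y hy
      by_cases h2 : ∀ l, iterD l f y = 0
      · exact Or.inl (eventually_zero_of_iterD hD hf hy h2)
      · push Not at h2
        obtain ⟨l, hl⟩ := h2
        exact Or.inr (mem_iUnion.2 ⟨l, hy, hl⟩)
  intro y hy
  exact (hsub hy).self_of_nhds

/-- The zero set is covered by countably many pieces of smooth hypersurface. -/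
lemma strat [SecondCountableTopology E] {f : E → ℂ} {D : Set E} (hD : IsOpen D) (hf : LineHol f D)
    (hne : ∀ x ∈ D, ¬ ∀ᶠ y in 𝓝 x, f y = 0) (Small : Set E → Prop)
    (hmono : ∀ K K', K' ⊆ K → Small K → Small K')
    (hSmall : ∀ g : E → ℂ, LineHol g D → ∀ z ∈ D, ∀ v, g z = 0 → dirD g v z ≠ 0 →
      ∃ U ∈ 𝓝 z, Small {x ∈ U | g x = 0}) :
    ∃ S : Set (Set E), S.Countable ∧ (∀ K ∈ S, Small K) ∧ {z ∈ D | f z = 0} ⊆ ⋃₀ S := by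
  let Z : ℕ → Set E := fun m => {z ∈ D | (∀ l : List E, l.length ≤ m → iterD l f z = 0) ∧
    ∃ l : List E, l.length = m + 1 ∧ iterD l f z ≠ 0}
  have hcov : {z ∈ D | f z = 0} ⊆ ⋃ m, Z m := by
    rintro z ⟨hz, hfz⟩
    have hex : ∃ k, ∃ l : List E, l.length = k ∧ iterD l f z ≠ 0 := by
      by_contra hcon
      push Not at hcon
      exact hne z hz (eventually_zero_of_iterD hD hf hz fun l => hcon _ l rfl)
    classical
    have hk := Nat.find_spec hex
    have hmin := fun j => Nat.find_min hex (m := j)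
    set k := Nat.find hex
    rcases k with _ | m
    · obtain ⟨l, hl, hl2⟩ := hk
      rw [List.length_eq_zero_iff] at hl
      subst hl
      exact absurd hfz hl2
    · refine mem_iUnion.2 ⟨m, hz, fun l hl => ?_, hk⟩
      by_contra hcon
      exact hmin l.length (by omega) ⟨l, rfl, hcon⟩
  have hloc : ∀ m, ∀ z ∈ Z m, ∃ U ∈ 𝓝[Z m] z, Small U := by
    rintro m z ⟨hz, hz1, l, hl, hl2⟩
    rcases l with _ | ⟨v, l⟩
    · simp at hl
    have hl' : l.length = m := by simpa using hl
    obtain ⟨U, hU, hS⟩ := hSmall _ (hf.iterD hD l) z hz v (hz1 l (by omega)) hl2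
    refine ⟨U ∩ Z m, Filter.inter_mem (mem_nhdsWithin_of_mem_nhds hU) self_mem_nhdsWithin, ?_⟩
    refine hmono _ _ ?_ hS
    rintro y ⟨hy, hy2⟩
    exact ⟨hy, hy2.2.1 l (by omega)⟩
  choose! U hU hUS using hloc
  have hc : ∀ m, ∃ t ⊆ Z m, t.Countable ∧ Z m ⊆ ⋃ x ∈ t, U m x := fun m =>
    TopologicalSpace.countable_cover_nhdsWithin (hU m)
  choose t ht htc htU using hc
  refine ⟨⋃ m, U m '' t m, countable_iUnion fun m => (htc m).image _, ?_, ?_⟩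
  · intro K hK
    obtain ⟨m, z, hz, rfl⟩ := by simpa using hK
    exact hUS m z (ht m hz)
  · intro z hz
    obtain ⟨m, hm⟩ := mem_iUnion.1 (hcov hz)
    obtain ⟨y, hy, hzy⟩ := mem_iUnion₂.1 (htU m hm)
    exact ⟨U m y, mem_iUnion.2 ⟨m, y, hy, rfl⟩, hzy⟩

end Strat

section Siegel

lemma LineHol.comp_affine {E E' : Type*} [NormedAddCommGroup E] [NormedSpace ℂ E]
    [NormedAddCommGroup E'] [NormedSpace ℂ E'] {f : E → ℂ} {D : Set E} (hf : LineHol f D)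
    {A : E' → E} (hA : Continuous A) {A' : E' → E} (hA' : ∀ (x v : E') (t : ℂ), A (x + t • v) = A x + t • A' v)
    {D' : Set E'} (hD' : ∀ x ∈ D', A x ∈ D) : LineHol (fun x => f (A x)) D' := by
  refine ⟨hf.1.comp hA.continuousOn hD', fun x v => ?_⟩
  simp only [hA']
  refine (hf.2 (A x) (A' v)).mono fun t ht => ?_
  have := hD' _ ht
  rwa [hA'] at this

lemma LineHol.const_mul {E : Type*} [NormedAddCommGroup E] [NormedSpace ℂ E] {f : E → ℂ} {D : Set E}
    (hf : LineHol f D) (c : ℂ) : LineHol (fun x => c * f x) D :=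
  ⟨continuousOn_const.mul hf.1, fun x v => (hf.2 x v).const_mul c⟩

lemma iterD_linear {E V : Type*} [NormedAddCommGroup E] [NormedSpace ℂ E] [AddCommGroup V] [Module ℂ V]
    {D : Set E} (hD : IsOpen D) (T : V → E → ℂ) (hT : ∀ c, LineHol (T c) D)
    (hlin : ∀ w ∈ D, IsLinearMap ℂ (fun c => T c w)) (l : List E) :
    ∀ w ∈ D, IsLinearMap ℂ (fun c => iterD l (T c) w) := by
  induction l with
  | nil => exact hlin
  | cons v l ih =>
    intro w hw
    have hd : ∀ c, HasDerivAt (fun t : ℂ => iterD l (T c) (w + t • v)) (dirD (iterD l (T c)) v w) 0 := by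
      intro c
      have := ((hT c).iterD hD l).hasDerivAt hD (x := w) (v := v) (t := 0) (by simpa using hw)
      simpa using this
    have hev : ∀ᶠ t : ℂ in 𝓝 0, w + t • v ∈ D := (isOpen_slice hD w v).mem_nhds (by simpa using hw)
    constructor
    · intro c c'
      have h1 := (hd c).add (hd c')
      have h2 : HasDerivAt (fun t : ℂ => iterD l (T (c + c')) (w + t • v)) (dirD (iterD l (T c)) v w + dirD (iterD l (T c')) v w) 0 := by
        refine h1.congr_of_eventuallyEq ?_
        filter_upwards [hev] with t ht
        exact (ih _ ht).map_add c c'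
      exact (hd (c + c')).unique h2
    · intro a c
      have h1 := (hd c).const_mul a
      have h2 : HasDerivAt (fun t : ℂ => iterD l (T (a • c)) (w + t • v)) (a * dirD (iterD l (T c)) v w) 0 := by
        refine h1.congr_of_eventuallyEq ?_
        filter_upwards [hev] with t ht
        exact (ih _ ht).map_smul a c
      exact (hd (a • c)).unique h2

/-- Cauchy estimate on the open unit disc. -/
lemma cauchy_unit {φ : ℂ → ℂ} {M : ℝ} (hφ : DifferentiableOn ℂ φ (ball 0 1))
    (hM : ∀ t ∈ ball (0:ℂ) 1, ‖φ t‖ ≤ M) (j : ℕ) : ‖(j.factorial : ℂ)⁻¹ * iteratedDeriv j φ 0‖ ≤ M := by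
  have h1 : ∀ r ∈ Ioo (0:ℝ) 1, ‖(j.factorial : ℂ)⁻¹ * iteratedDeriv j φ 0‖ * r ^ j ≤ M := by
    intro r hr
    have hsub : closedBall (0:ℂ) r ⊆ ball 0 1 := closedBall_subset_ball hr.2
    have := Complex.norm_iteratedDeriv_le_of_forall_mem_sphere_norm_le (f := φ) (c := 0) (C := M) j hr.1
      ((hφ.mono (closure_ball_subset_closedBall.trans hsub)).diffContOnCl)
      (fun z hz => hM z (hsub (sphere_subset_closedBall hz)))
    rw [norm_mul, norm_inv]
    have hf : (0:ℝ) < j.factorial := by positivity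
    have hr0 := hr.1
    simp only [Complex.norm_natCast]
    rw [le_div_iff₀ (by positivity)] at this
    rw [mul_assoc, inv_mul_le_iff₀ hf]
    exact this
  have hlim : Filter.Tendsto (fun r : ℝ => ‖(j.factorial : ℂ)⁻¹ * iteratedDeriv j φ 0‖ * r ^ j) (𝓝[<] 1)
      (𝓝 (‖(j.factorial : ℂ)⁻¹ * iteratedDeriv j φ 0‖ * 1 ^ j)) := by
    refine Filter.Tendsto.mono_left ?_ nhdsWithin_le_nhds
    exact (continuous_const.mul (continuous_pow j)).continuousAt
  rw [one_pow, mul_one] at hlim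
  refine le_of_tendsto hlim ?_
  filter_upwards [Ioo_mem_nhdsLT (show (0:ℝ) < 1 by norm_num)] with r hr
  exact h1 r hr

lemma taylor_rem {φ : ℂ → ℂ} {M : ℝ} (hφ : DifferentiableOn ℂ φ (ball 0 1))
    (hM : ∀ t ∈ ball (0:ℂ) 1, ‖φ t‖ ≤ M) (N : ℕ) {t : ℂ} (ht : t ∈ ball (0:ℂ) (1/2)) :
    ‖φ t - ∑ j ∈ Finset.range N, (j.factorial : ℂ)⁻¹ * iteratedDeriv j φ 0 * t ^ j‖ ≤ 2 * M / 2 ^ N := by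
  have ht1 : t ∈ ball (0:ℂ) 1 := ball_subset_ball (by norm_num) ht
  have hs := Complex.hasSum_taylorSeries_on_ball hφ ht1
  have hs' : HasSum (fun j : ℕ => (j.factorial : ℂ)⁻¹ * iteratedDeriv j φ 0 * t ^ j) (φ t) := by
    have e : (fun j : ℕ => (j.factorial : ℂ)⁻¹ * iteratedDeriv j φ 0 * t ^ j) =
        fun j : ℕ => (j.factorial : ℂ)⁻¹ • (t - 0) ^ j • iteratedDeriv j φ 0 := by
      ext j
      simp only [smul_eq_mul, sub_zero]
      ring
    rw [e]
    exact hs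
  have hs2 := (hasSum_nat_add_iff' N).2 hs'
  have hM0 : 0 ≤ M := (norm_nonneg _).trans (hM t ht1)
  have hg : HasSum (fun j : ℕ => M / 2 ^ N * (1/2:ℝ) ^ j) (M / 2 ^ N * 2) := hasSum_geometric_two.mul_left _
  rw [← hs2.tsum_eq]
  have := tsum_of_norm_bounded hg (f := fun j : ℕ => ((j + N).factorial : ℂ)⁻¹ * iteratedDeriv (j + N) φ 0 * t ^ (j + N)) ?_
  · calc _ ≤ _ := this
      _ = _ := by ring
  · intro j
    rw [norm_mul, norm_pow]
    have e1 := cauchy_unit hφ hM (j + N)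
    have e2 : ‖t‖ ≤ 1/2 := (mem_ball_zero_iff.1 ht).le
    calc _ ≤ M * (1/2) ^ (j + N) := by gcongr
      _ = _ := by rw [pow_add]; field_simp; rw [mul_assoc, ← mul_pow]; norm_num

lemma cons_mem_ball {k : ℕ} {r : ℝ} (hr : 0 < r) {t : ℂ} {w : Fin k → ℂ} (ht : t ∈ ball (0:ℂ) r) (hw : w ∈ ball (0 : Fin k → ℂ) r) :
    (Fin.cons t w : Fin (k+1) → ℂ) ∈ ball (0 : Fin (k+1) → ℂ) r := by
  rw [mem_ball_zero_iff, pi_norm_lt_iff hr] at *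
  intro i
  refine Fin.cases ?_ ?_ i
  · simpa using ht
  · intro i; simpa using hw i

lemma siegel_aux (N : ℕ) {V : Type*} [AddCommGroup V] [Module ℂ V] : ∀ (k : ℕ) (T : V → (Fin k → ℂ) → ℂ),
    (∀ c, LineHol (T c) (ball 0 1)) → (∀ w ∈ ball (0 : Fin k → ℂ) 1, IsLinearMap ℂ (fun c => T c w)) →
    ∃ Λ : V →ₗ[ℂ] ((Fin k → Fin N) → ℂ), ∀ c, Λ c = 0 → ∀ M : ℝ, (∀ w ∈ ball (0 : Fin k → ℂ) 1, ‖T c w‖ ≤ M) →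
      ∀ w ∈ ball (0 : Fin k → ℂ) (1/2), ‖T c w‖ ≤ 2 * 3 ^ k * (M / 2 ^ N) := by
  intro k
  induction k with
  | zero =>
    intro T hT hlin
    have h0 : (0 : Fin 0 → ℂ) ∈ ball (0 : Fin 0 → ℂ) 1 := by simp
    refine ⟨LinearMap.pi fun _ => (hlin 0 h0).mk' _, fun c hc M hM w hw => ?_⟩
    have h1 := congrFun hc (fun i => i.elim0)
    have h2 : T c 0 = 0 := h1
    have : w = 0 := Subsingleton.elim _ _
    rw [this, h2, norm_zero]
    have hM0 : 0 ≤ M := (norm_nonneg _).trans (hM 0 h0)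
    positivity
  | succ k ih =>
    intro T hT hlin
    let e : Fin (k+1) → ℂ := Fin.cons 1 0
    have hcons : ∀ (t : ℂ) (w : Fin k → ℂ), (Fin.cons 0 w : Fin (k+1) → ℂ) + t • e = Fin.cons t w := by
      intro t w
      ext i
      refine Fin.cases ?_ (fun i => ?_) i <;> simp [e]
    let Tj : ℕ → V → (Fin k → ℂ) → ℂ := fun j c w =>
      (j.factorial : ℂ)⁻¹ * iterD (List.replicate j e) (T c) (Fin.cons 0 w)
    have hin0 : ∀ w ∈ ball (0 : Fin k → ℂ) 1, (Fin.cons 0 w : Fin (k+1) → ℂ) ∈ ball (0 : Fin (k+1) → ℂ) 1 :=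
      fun w hw => cons_mem_ball one_pos (by simp) hw
    have hTj : ∀ j c, LineHol (Tj j c) (ball 0 1) := by
      intro j c
      refine LineHol.const_mul (LineHol.comp_affine (A := fun w : Fin k → ℂ => (Fin.cons 0 w : Fin (k+1) → ℂ))
        (A' := fun w : Fin k → ℂ => (Fin.cons 0 w : Fin (k+1) → ℂ))
        ((hT c).iterD isOpen_ball (List.replicate j e)) ?_ ?_ hin0) _
      · refine continuous_pi fun i => ?_
        refine Fin.cases ?_ (fun i => ?_) i
        · simpa using continuous_const
        · simpa using continuous_apply i
      · intro x v t
        ext i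
        refine Fin.cases ?_ (fun i => ?_) i <;> simp
    have hTjlin : ∀ j, ∀ w ∈ ball (0 : Fin k → ℂ) 1, IsLinearMap ℂ (fun c => Tj j c w) := by
      intro j w hw
      have := iterD_linear isOpen_ball T hT hlin (List.replicate j e) _ (hin0 w hw)
      constructor
      · intro c c'
        simp only [Tj, this.map_add]; ring
      · intro a c
        simp only [Tj, this.map_smul, smul_eq_mul]; ring
    choose Λ hΛ using fun j => ih (Tj j) (hTj j) (hTjlin j)
    refine ⟨LinearMap.pi fun b => (LinearMap.proj (Fin.tail b)).comp (Λ (b 0)), fun c hc M hM w hw => ?_⟩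
    have hΛ0 : ∀ j < N, Λ j c = 0 := by
      intro j hj
      ext b
      have := congrFun hc (Fin.cons ⟨j, hj⟩ b)
      simpa using this
    set t := w 0 with htdef
    set w' := Fin.tail w with hw'def
    have hwt : w = Fin.cons t w' := (Fin.cons_self_tail w).symm
    have ht : t ∈ ball (0:ℂ) (1/2) := by
      rw [mem_ball_zero_iff] at *
      exact (norm_le_pi_norm w 0).trans_lt hw
    have hw'2 : w' ∈ ball (0:Fin k → ℂ) (1/2) := by
      rw [mem_ball_zero_iff, pi_norm_lt_iff (by norm_num)] at *
      intro i; exact hw i.succ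
    have hslice : ∀ x ∈ ball (0:Fin k → ℂ) 1, DifferentiableOn ℂ (fun t : ℂ => T c (Fin.cons 0 x + t • e)) (ball 0 1) := by
      intro x hx
      refine ((hT c).2 (Fin.cons 0 x) e).mono fun s hs => ?_
      simp only [mem_ofPred_eq]
      rw [hcons]; exact cons_mem_ball one_pos hs hx
    have hsM : ∀ x ∈ ball (0:Fin k → ℂ) 1, ∀ s ∈ ball (0:ℂ) 1, ‖T c (Fin.cons 0 x + s • e)‖ ≤ M := by
      intro x hx s hs
      rw [hcons]; exact hM _ (cons_mem_ball one_pos hs hx)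
    have hcoef : ∀ x ∈ ball (0:Fin k → ℂ) 1, ∀ j : ℕ, Tj j c x = (j.factorial : ℂ)⁻¹ * iteratedDeriv j (fun t : ℂ => T c (Fin.cons 0 x + t • e)) 0 := by
      intro x hx j
      simp only [Tj]
      rw [iterD_replicate isOpen_ball (hT c) (Fin.cons 0 x) e j 0 (by simpa using hin0 x hx)]
      simp
    have hTjM : ∀ j, ∀ x ∈ ball (0:Fin k → ℂ) 1, ‖Tj j c x‖ ≤ M := by
      intro j x hx
      rw [hcoef x hx]
      exact cauchy_unit (hslice x hx) (hsM x hx) j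
    have hw'1 : w' ∈ ball (0:Fin k → ℂ) 1 := ball_subset_ball (by norm_num) hw'2
    have hrem := taylor_rem (hslice w' hw'1) (hsM w' hw'1) N ht
    simp only [← hcoef w' hw'1] at hrem
    rw [hcons, ← hwt] at hrem
    have hM0 : 0 ≤ M := (norm_nonneg _).trans (hM _ (ball_subset_ball (by norm_num) hw))
    set δ := M / 2 ^ N with hδ
    have hδ0 : 0 ≤ δ := by positivity
    have hsum : ‖∑ j ∈ Finset.range N, Tj j c w' * t ^ j‖ ≤ 2 * (2 * 3 ^ k * δ) := by
      calc _ ≤ ∑ j ∈ Finset.range N, ‖Tj j c w' * t ^ j‖ := norm_sum_le _ _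
        _ ≤ ∑ j ∈ Finset.range N, (2 * 3 ^ k * δ) * (1/2) ^ j := by
          refine Finset.sum_le_sum fun j hj => ?_
          rw [norm_mul, norm_pow]
          have e2 : ‖t‖ ≤ 1/2 := (mem_ball_zero_iff.1 ht).le
          have := hΛ j c (hΛ0 j (Finset.mem_range.1 hj)) M (hTjM j) w' hw'2
          gcongr
        _ = (2 * 3 ^ k * δ) * ∑ j ∈ Finset.range N, (1/2:ℝ) ^ j := by rw [Finset.mul_sum]
        _ ≤ (2 * 3 ^ k * δ) * 2 := by
          gcongr
          exact sum_geometric_two_le N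
        _ = _ := by ring
    have h3 : (1:ℝ) ≤ 3 ^ k := one_le_pow₀ (by norm_num)
    calc ‖T c w‖ = ‖(T c w - ∑ j ∈ Finset.range N, Tj j c w' * t ^ j) + ∑ j ∈ Finset.range N, Tj j c w' * t ^ j‖ := by congr 1; ring
      _ ≤ _ := norm_add_le _ _
      _ ≤ 2 * M / 2 ^ N + 2 * (2 * 3 ^ k * δ) := add_le_add hrem hsum
      _ = 2 * δ + 4 * 3 ^ k * δ := by rw [hδ]; ring
      _ ≤ 2 * 3 ^ (k+1) * δ := by rw [pow_succ]; nlinarith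

end Siegel

section LemmaA

/-- the polynomial with coefficients `c`. -/
def mp {n d : ℕ} (c : (Fin n → Fin d) → ℂ) (z : Fin n → ℂ) : ℂ := ∑ a, c a * ∏ i, z i ^ (a i : ℕ)

/-- sets on which there are normalized polynomials very small compared to their degree. -/
def PolySmall {n : ℕ} (K : Set (Fin n → ℂ)) : Prop :=
  ∀ A : ℝ, ∃ d : ℕ, 1 ≤ d ∧ ∃ c : (Fin n → Fin d) → ℂ, (∀ a, ‖c a‖ ≤ 1) ∧ (∃ a, ‖c a‖ = 1) ∧
    ∀ z ∈ K, ‖mp c z‖ ≤ Real.exp (-(A * d))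

lemma PolySmall.mono {n : ℕ} (K K' : Set (Fin n → ℂ)) (h : K' ⊆ K) (hK : PolySmall K) : PolySmall K' := by
  intro A
  obtain ⟨d, hd, c, h1, h2, h3⟩ := hK A
  exact ⟨d, hd, c, h1, h2, fun z hz => h3 z (h hz)⟩

lemma mp_differentiable {n d : ℕ} (c : (Fin n → Fin d) → ℂ) : Differentiable ℂ (mp c) := by
  unfold mp
  fun_prop

lemma norm_mp_le {n d : ℕ} (c : (Fin n → Fin d) → ℂ) (hc : ∀ a, ‖c a‖ ≤ 1) (z : Fin n → ℂ) {R : ℝ} (hR : 1 ≤ R)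
    (hz : ‖z‖ ≤ R) : ‖mp c z‖ ≤ (2 * R) ^ (n * d) := by
  have h1 : ∀ a : Fin n → Fin d, ‖c a * ∏ i, z i ^ (a i : ℕ)‖ ≤ R ^ (n * d) := by
    intro a
    rw [norm_mul, norm_prod]
    have : ∏ i, ‖z i ^ (a i : ℕ)‖ ≤ ∏ i : Fin n, R ^ d := by
      refine Finset.prod_le_prod (fun i _ => norm_nonneg _) fun i _ => ?_
      rw [norm_pow]
      calc ‖z i‖ ^ (a i : ℕ) ≤ R ^ (a i : ℕ) := by gcongr; exact (norm_le_pi_norm z i).trans hz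
        _ ≤ R ^ d := pow_le_pow_right₀ hR (a i).2.le
    calc _ ≤ 1 * ∏ i : Fin n, R ^ d := by gcongr; exact hc a
      _ = R ^ (n * d) := by simp [← pow_mul, mul_comm]
  calc ‖mp c z‖ ≤ ∑ a : Fin n → Fin d, ‖c a * ∏ i, z i ^ (a i : ℕ)‖ := norm_sum_le _ _
    _ ≤ ∑ a : Fin n → Fin d, R ^ (n * d) := Finset.sum_le_sum fun a _ => h1 a
    _ = (d:ℝ) ^ n * R ^ (n * d) := by simp
    _ ≤ (2 ^ (n * d)) * R ^ (n * d) := by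
      gcongr
      rw [mul_comm, pow_mul]
      gcongr
      exact_mod_cast Nat.lt_two_pow_self.le
    _ = _ := by rw [mul_pow]

lemma lineHol_of_differentiableOn {E : Type*} [NormedAddCommGroup E] [NormedSpace ℂ E] {f : E → ℂ} {D : Set E}
    (hf : DifferentiableOn ℂ f D) : LineHol f D :=
  ⟨hf.continuousOn, fun x v => hf.comp (by fun_prop) fun t ht => ht⟩

lemma polySmall_image {k : ℕ} {ψ : (Fin k → ℂ) → (Fin (k+1) → ℂ)} {R : ℝ} (hR : 1 ≤ R)
    (hψ : DifferentiableOn ℂ ψ (ball 0 1)) (hψR : ∀ w ∈ ball (0 : Fin k → ℂ) 1, ‖ψ w‖ ≤ R) :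
    PolySmall (ψ '' ball 0 (1/2)) := by
  intro A
  set c0 : ℝ := Real.log (2 * 3 ^ k) with hc0
  have hc0' : 0 ≤ c0 := Real.log_nonneg (by have : (1:ℝ) ≤ 3 ^ k := one_le_pow₀ (by norm_num)
                                            linarith)
  obtain ⟨s0, hs0⟩ := exists_nat_gt (2 * (A + c0 + (k+1) * Real.log (2 * R)) / Real.log 2)
  set s := s0 + 1 with hs
  have hl2 : 0 < Real.log 2 := Real.log_pos (by norm_num)
  have hsA : 2 * (A + c0 + (k+1) * Real.log (2 * R)) ≤ s * Real.log 2 := by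
    rw [div_lt_iff₀ hl2] at hs0
    rw [hs]; push_cast; nlinarith
  set d := 2 * s ^ k with hd
  set N := s ^ (k+1) with hN
  have hd1 : 1 ≤ d := by
    have : 1 ≤ s ^ k := Nat.one_le_pow _ _ (by omega)
    omega
  have hdim : N ^ k < d ^ (k+1) := by
    rw [hd, hN, mul_pow, ← pow_mul, ← pow_mul, mul_comm (k+1) k]
    have h1 : 0 < s ^ (k * (k+1)) := by positivity
    have h2 : 2 ≤ 2 ^ (k+1) := by
      calc 2 = 2 ^ 1 := by norm_num
        _ ≤ 2 ^ (k+1) := Nat.pow_le_pow_right (by norm_num) (by omega)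
    nlinarith
  obtain ⟨Λ, hΛ⟩ := siegel_aux N k (V := (Fin (k+1) → Fin d) → ℂ) (fun c w => mp c (ψ w))
    (fun c => lineHol_of_differentiableOn ((mp_differentiable c).comp_differentiableOn hψ))
    (fun w _ => ⟨fun c c' => by simp [mp, add_mul, Finset.sum_add_distrib],
      fun a c => by simp [mp, Finset.mul_sum, mul_assoc]⟩)
  have hker : LinearMap.ker Λ ≠ ⊥ := by
    apply LinearMap.ker_ne_bot_of_finrank_lt
    simpa using hdim
  obtain ⟨c, hcΛ, hc0⟩ := (Submodule.ne_bot_iff _).1 hker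
  rw [LinearMap.mem_ker] at hcΛ
  have : Nonempty (Fin (k+1) → Fin d) := ⟨fun _ => ⟨0, by omega⟩⟩
  obtain ⟨a0, ha0⟩ := Finite.exists_max (fun a => ‖c a‖)
  have hm : 0 < ‖c a0‖ := by
    rw [norm_pos_iff]
    intro h
    apply hc0
    ext a
    have := ha0 a
    rw [h, norm_zero] at this
    exact norm_le_zero_iff.1 this
  set c' : (Fin (k+1) → Fin d) → ℂ := ((‖c a0‖⁻¹ : ℝ) : ℂ) • c with hc'
  have hn : ∀ a, ‖c' a‖ = ‖c a‖ / ‖c a0‖ := by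
    intro a
    simp [hc', div_eq_inv_mul]
  have hc1 : ∀ a, ‖c' a‖ ≤ 1 := fun a => by
    rw [hn, div_le_one hm]; exact ha0 a
  refine ⟨d, hd1, c', hc1, ⟨a0, by rw [hn, div_self hm.ne']⟩, ?_⟩
  rintro _ ⟨w, hw, rfl⟩
  have hb := hΛ c' (by rw [hc', map_smul, hcΛ, smul_zero]) ((2 * R) ^ ((k+1) * d))
    (fun w hw => norm_mp_le c' hc1 _ hR (hψR w hw)) w hw
  refine hb.trans ?_
  have hR0 : 0 < 2 * R := by linarith
  have e1 : 2 * 3 ^ k * ((2 * R) ^ ((k+1) * d) / 2 ^ N) = Real.exp (c0 + ((k+1) * d) * Real.log (2*R) - N * Real.log 2) := by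
    rw [Real.exp_sub, Real.exp_add, Real.exp_log (by positivity)]
    have : ((k:ℝ)+1) * d = (((k+1) * d : ℕ) : ℝ) := by push_cast; ring
    rw [this, Real.exp_nat_mul, Real.exp_nat_mul, Real.exp_log hR0, Real.exp_log (by norm_num)]
    ring
  rw [e1]
  apply Real.exp_le_exp.2
  have hdR : (1:ℝ) ≤ d := by exact_mod_cast hd1
  have hNd : (N:ℝ) = s * d / 2 := by
    rw [hN, hd]; push_cast; ring
  rw [hNd]
  nlinarith [mul_le_mul_of_nonneg_right hsA (by linarith : (0:ℝ) ≤ d), mul_le_mul_of_nonneg_left hdR hc0']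

/-- the derivative of the straightening map -/
def straightEquiv {n : ℕ} (i : Fin n) (L : (Fin n → ℂ) →L[ℂ] ℂ) (hL : L (Pi.single i 1) ≠ 0) :
    (Fin n → ℂ) ≃L[ℂ] (Fin n → ℂ) :=
  ContinuousLinearEquiv.equivOfInverse
    (ContinuousLinearMap.id ℂ _ + (L - ContinuousLinearMap.proj i).smulRight (Pi.single i 1))
    (ContinuousLinearMap.id ℂ _ + ((L (Pi.single i 1))⁻¹ • (ContinuousLinearMap.proj i - L)).smulRight (Pi.single i 1))
    (by
      intro x
      ext j
      simp
      field_simp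
      ring)
    (by
      intro x
      ext j
      simp
      field_simp
      ring)

lemma small_graph {k : ℕ} {D : Set (Fin (k+1) → ℂ)} (hD : IsOpen D) {g : (Fin (k+1) → ℂ) → ℂ} (hg : LineHol g D)
    {z : Fin (k+1) → ℂ} (hz : z ∈ D) {v : Fin (k+1) → ℂ} (hgz : g z = 0) (hv : dirD g v z ≠ 0) :
    ∃ U ∈ 𝓝 z, PolySmall {x ∈ U | g x = 0} := by
  obtain ⟨L, hLv, hL⟩ := hg.exists_fderiv hD hz
  have hcd : ContDiffAt ℂ 1 g z := ((hg.contDiffOn hD).contDiffAt (hD.mem_nhds hz)).of_le (by norm_num)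
  have hi : ∃ i, L (Pi.single i 1) ≠ 0 := by
    by_contra hcon
    push Not at hcon
    apply hv
    rw [← hLv]
    have : v = ∑ i, v i • (Pi.single i (1:ℂ) : Fin (k+1) → ℂ) := by
      ext j
      simp [Finset.sum_apply, Pi.single_apply]
    rw [this, map_sum]
    simp [hcon]
  obtain ⟨i, hi⟩ := hi
  let F : (Fin (k+1) → ℂ) → (Fin (k+1) → ℂ) := fun x => x + (g x - x i) • Pi.single i 1
  have hF : HasFDerivAt F (straightEquiv i L hi : (Fin (k+1) → ℂ) →L[ℂ] (Fin (k+1) → ℂ)) z := by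
    have h1 : HasFDerivAt (fun x : Fin (k+1) → ℂ => x i) (ContinuousLinearMap.proj (R := ℂ) (φ := fun _ : Fin (k+1) => ℂ) i) z :=
      (ContinuousLinearMap.proj (R := ℂ) (φ := fun _ : Fin (k+1) => ℂ) i).hasFDerivAt
    exact (hasFDerivAt_id z).add ((hL.sub h1).smul_const _)
  have hFc : ContDiffAt ℂ 1 F z := by
    refine contDiffAt_id.add (ContDiffAt.smul (hcd.sub ?_) contDiffAt_const)
    exact (contDiff_apply ℂ ℂ i).contDiffAt
  have hFi : ∀ x, F x i = g x := by intro x; simp [F]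
  have hFj : ∀ x j, j ≠ i → F x j = x j := by intro x j hj; simp [F, hj]
  set G := hFc.localInverse hF (by norm_num) with hG
  have hGc : ContDiffAt ℂ 1 G (F z) := hFc.to_localInverse hF (by norm_num)
  have hGF : ∀ᶠ x in 𝓝 z, G (F x) = x := by
    have := hFc.hasStrictFDerivAt' hF (by norm_num)
    exact this.eventually_left_inverse
  have hGz : G (F z) = z := hGF.self_of_nhds
  -- neighbourhood where G is differentiable and bounded
  have hGd : ∀ᶠ y in 𝓝 (F z), DifferentiableAt ℂ G y ∧ ‖G y‖ < ‖z‖ + 1 := by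
    refine Filter.Eventually.and ?_ ?_
    · filter_upwards [hGc.eventually (by simp)] with y hy
      exact hy.differentiableAt (by norm_num)
    · refine hGc.continuousAt.norm.eventually_lt_const ?_
      simp only [hGz]; linarith
  obtain ⟨ρ, hρ, hball⟩ := Metric.eventually_nhds_iff_ball.1 hGd
  let ι : (Fin k → ℂ) → (Fin (k+1) → ℂ) := fun w => i.insertNth 0 (fun j => z (i.succAbove j) + (ρ:ℂ) * w j)
  have hι : ∀ w ∈ ball (0 : Fin k → ℂ) 1, ι w ∈ ball (F z) ρ := by
    intro w hw
    rw [mem_ball, dist_pi_lt_iff hρ]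
    intro j
    refine Fin.succAboveCases i ?_ (fun j => ?_) j
    · simp [ι, hFi, hgz, hρ]
    · rw [hFj z _ (Fin.succAbove_ne i j)]
      simp only [ι, Fin.insertNth_apply_succAbove, dist_self_add_left, norm_mul, Complex.norm_real,
        Real.norm_eq_abs, abs_of_pos hρ]
      have : ‖w j‖ < 1 := (norm_le_pi_norm w j).trans_lt (mem_ball_zero_iff.1 hw)
      nlinarith
  have hιd : Differentiable ℂ ι := by
    rw [differentiable_pi]
    intro j
    refine Fin.succAboveCases i ?_ (fun j => ?_) j
    · simp [ι]
    · simp only [ι, Fin.insertNth_apply_succAbove]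
      fun_prop
  have hsm := polySmall_image (ψ := fun w => G (ι w)) (R := ‖z‖ + 1) (by linarith [norm_nonneg z])
    (fun w hw => (((hball _ (hι w hw)).1).comp w (hιd w)).differentiableWithinAt)
    (fun w hw => (hball _ (hι w hw)).2.le)
  refine ⟨{x | G (F x) = x} ∩ ball z (ρ/2), Filter.inter_mem hGF (ball_mem_nhds _ (by positivity)), ?_⟩
  refine hsm.mono _ _ ?_
  rintro x ⟨⟨hx1, hx2⟩, hgx⟩
  refine ⟨fun j => (x (i.succAbove j) - z (i.succAbove j)) / ρ, ?_, ?_⟩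
  · rw [mem_ball_zero_iff, pi_norm_lt_iff (by norm_num)]
    intro j
    rw [norm_div, Complex.norm_real, Real.norm_eq_abs, abs_of_pos hρ, div_lt_iff₀ hρ]
    have := (dist_pi_lt_iff (by positivity)).1 (mem_ball.1 hx2) (i.succAbove j)
    rw [dist_eq_norm] at this
    linarith
  · have : ι (fun j => (x (i.succAbove j) - z (i.succAbove j)) / ρ) = F x := by
      ext j
      refine Fin.succAboveCases i ?_ (fun j => ?_) j
      · simp [ι, hFi, hgx]
      · rw [hFj x _ (Fin.succAbove_ne i j)]
        have : (ρ:ℂ) ≠ 0 := by exact_mod_cast hρ.ne'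
        simp only [ι, Fin.insertNth_apply_succAbove]
        field_simp
        ring
    simp only [this]
    exact hx1

end LemmaA

section Mahler

lemma mahler_one (q : ℂ[X]) {d : ℕ} {B : ℝ} (hB : 0 ≤ B) (hq : q.natDegree ≤ d)
    (hb : ∀ t : ℂ, ‖t‖ = 1 → ‖q.eval t‖ ≤ Real.exp B) (α : ℕ) (hα : q.coeff α ≠ 0) :
    ∫⁻ θ in Ioc 0 (2 * Real.pi), ENNReal.ofReal |Real.log ‖q.eval (circleMap 0 1 θ)‖| ≤
      ENNReal.ofReal (2 * Real.pi * (2 * B + d + |Real.log ‖q.coeff α‖|)) := by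
  set f : ℝ → ℝ := fun θ => Real.log ‖q.eval (circleMap 0 1 θ)‖ with hf
  have hIntv : IntervalIntegrable f MeasureTheory.volume 0 (2 * Real.pi) := q.intervalIntegrable_mahlerMeasure
  have h2pi : (0:ℝ) ≤ 2 * Real.pi := by positivity
  have hInt : MeasureTheory.IntegrableOn f (Ioc 0 (2 * Real.pi)) :=
    (intervalIntegrable_iff_integrableOn_Ioc_of_le h2pi).1 hIntv
  have hq0 : q ≠ 0 := by rintro rfl; simp at hα
  have hfB : ∀ θ, f θ ≤ B := by
    intro θ
    have h1 := hb (circleMap 0 1 θ) (by simp)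
    simp only [hf]
    rcases eq_or_ne (q.eval (circleMap 0 1 θ)) 0 with h0 | h0
    · rw [h0]; simpa using hB
    · exact (Real.log_le_iff_le_exp (norm_pos_iff.2 h0)).2 h1
  have hm : (2 * Real.pi)⁻¹ * ∫ θ in Ioc 0 (2 * Real.pi), f θ = q.logMahlerMeasure := by
    rw [logMahlerMeasure_def, Real.circleAverage_def, intervalIntegral.integral_of_le h2pi, smul_eq_mul]
  have hlow : -(d + |Real.log ‖q.coeff α‖|) ≤ q.logMahlerMeasure := by
    have h1 := q.norm_coeff_le_choose_mul_mahlerMeasure α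
    have hc : 0 < ‖q.coeff α‖ := norm_pos_iff.2 hα
    have hmp := mahlerMeasure_pos_of_ne_zero hq0
    have hch : ((q.natDegree.choose α : ℕ) : ℝ) ≤ 2 ^ d := by
      have : q.natDegree.choose α ≤ 2 ^ q.natDegree := Nat.choose_le_two_pow _ _
      exact_mod_cast this.trans (Nat.pow_le_pow_right (by norm_num) hq)
    have h2 : ‖q.coeff α‖ ≤ 2 ^ d * q.mahlerMeasure := h1.trans (by gcongr)
    have h3 := Real.log_le_log hc h2
    rw [Real.log_mul (by positivity) hmp.ne', Real.log_pow, ← logMahlerMeasure_eq_log_MahlerMeasure] at h3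
    have h4 : Real.log 2 ≤ 1 := by linarith [Real.log_two_lt_d9]
    have h5 : (d:ℝ) * Real.log 2 ≤ d := by
      have : (0:ℝ) ≤ d := by positivity
      nlinarith
    have := neg_abs_le (Real.log ‖q.coeff α‖)
    linarith
  have habs : MeasureTheory.IntegrableOn (fun θ => |f θ|) (Ioc 0 (2 * Real.pi)) := hInt.abs
  rw [← MeasureTheory.ofReal_integral_eq_lintegral_ofReal habs (Filter.Eventually.of_forall fun _ => abs_nonneg _)]
  apply ENNReal.ofReal_le_ofReal
  have hcI : MeasureTheory.IntegrableOn (fun _ : ℝ => 2 * B) (Ioc 0 (2 * Real.pi)) := by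
    exact MeasureTheory.integrableOn_const (by rw [Real.volume_Ioc]; exact ENNReal.ofReal_ne_top)
  have hle : ∫ θ in Ioc 0 (2 * Real.pi), |f θ| ≤ ∫ θ in Ioc 0 (2 * Real.pi), (2 * B - f θ) := by
    refine MeasureTheory.integral_mono habs (hcI.sub hInt) fun θ => ?_
    have := hfB θ
    rw [abs_le']
    constructor <;> linarith
  rw [MeasureTheory.integral_sub hcI hInt] at hle
  have hconst : ∫ θ in Ioc 0 (2 * Real.pi), (2 * B) = 2 * Real.pi * (2 * B) := by
    simp [Real.pi_pos.le]
  rw [hconst] at hle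
  have hpi : 0 < 2 * Real.pi := by positivity
  have hI : ∫ θ in Ioc 0 (2 * Real.pi), f θ = 2 * Real.pi * q.logMahlerMeasure := by
    rw [← hm]; field_simp
  rw [hI] at hle
  nlinarith

lemma mahler_step (q : ℕ → ℂ[X]) (d : ℕ → ℕ) (ε : ℕ → ℝ) (hε : ∀ j, 0 ≤ ε j) (hεd : Summable fun j => ε j * d j)
    {C : ℝ} (hC : 0 ≤ C) (hq : ∀ j, (q j).natDegree ≤ d j)
    (hb : ∀ j, ∀ t : ℂ, ‖t‖ = 1 → ‖(q j).eval t‖ ≤ Real.exp (C * d j)) (α : ℕ → ℕ)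
    (hα : ∀ j, (q j).coeff (α j) ≠ 0) (hs : Summable fun j => ε j * |Real.log ‖(q j).coeff (α j)‖|) :
    ∃ t : ℂ, ‖t‖ = 1 ∧ (∀ j, (q j).eval t ≠ 0) ∧ Summable fun j => ε j * |Real.log ‖(q j).eval t‖| := by
  let F : ℕ → ℝ → ENNReal := fun j θ => ENNReal.ofReal (ε j) * ENNReal.ofReal |Real.log ‖(q j).eval (circleMap 0 1 θ)‖|
  have hF : ∀ j, Measurable (F j) := by
    intro j
    have : Continuous fun θ => ‖(q j).eval (circleMap 0 1 θ)‖ :=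
      ((q j).continuous.comp (continuous_circleMap 0 1)).norm
    have := this.measurable
    simp only [F]
    fun_prop
  set μ : MeasureTheory.Measure ℝ := MeasureTheory.volume.restrict (Ioc 0 (2 * Real.pi)) with hμ
  have hbound : ∀ j, ∫⁻ θ, F j θ ∂μ ≤ ENNReal.ofReal (2 * Real.pi * ((2 * C + 1) * (ε j * d j) + ε j * |Real.log ‖(q j).coeff (α j)‖|)) := by
    intro j
    simp only [F]
    rw [MeasureTheory.lintegral_const_mul' _ _ ENNReal.ofReal_ne_top]
    have h1 := mahler_one (q j) (B := C * d j) (by positivity) (hq j) (hb j) (α j) (hα j)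
    calc _ ≤ ENNReal.ofReal (ε j) * ENNReal.ofReal
          (2 * Real.pi * (2 * (C * d j) + d j + |Real.log ‖(q j).coeff (α j)‖|)) := by
          gcongr
      _ = _ := by
          rw [← ENNReal.ofReal_mul (hε j)]
          congr 1; ring
  have hfin : ∫⁻ θ, ∑' j, F j θ ∂μ ≠ ⊤ := by
    rw [MeasureTheory.lintegral_tsum fun j => (hF j).aemeasurable]
    have hsum : Summable fun j => 2 * Real.pi * ((2 * C + 1) * (ε j * d j) + ε j * |Real.log ‖(q j).coeff (α j)‖|) :=
      ((hεd.mul_left _).add hs).mul_left _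
    refine ne_top_of_le_ne_top ?_ (ENNReal.tsum_le_tsum hbound)
    exact hsum.tsum_ofReal_ne_top
  have h1 : ∀ᵐ θ ∂μ, ∑' j, F j θ < ⊤ :=
    MeasureTheory.ae_lt_top (Measurable.tsum hF) hfin
  have h2 : ∀ᵐ θ ∂μ, ∀ j, (q j).eval (circleMap 0 1 θ) ≠ 0 := by
    rw [MeasureTheory.ae_all_iff]
    intro j
    have hq0 : q j ≠ 0 := by intro h; have := hα j; rw [h] at this; simp at this
    have hcount : ({t : ℂ | (q j).IsRoot t}).Countable := (finite_setOfPred_isRoot hq0).countable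
    have := (hcount.preimage_circleMap 0 (R := 1) one_ne_zero).measure_zero MeasureTheory.volume
    have h3 : ∀ᵐ θ : ℝ, (q j).eval (circleMap 0 1 θ) ≠ 0 := by
      rw [MeasureTheory.ae_iff]
      convert this using 2
      ext θ; simp [IsRoot]
    exact MeasureTheory.ae_restrict_of_ae h3
  have hμ0 : μ ≠ 0 := by
    rw [hμ, Ne, MeasureTheory.Measure.restrict_eq_zero]
    simp [Real.pi_pos]
  have : Filter.NeBot (MeasureTheory.ae μ) := MeasureTheory.ae_neBot.2 hμ0
  obtain ⟨θ, hθ1, hθ2⟩ := (h1.and h2).exists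
  refine ⟨circleMap 0 1 θ, by simp, hθ2, ?_⟩
  have := ENNReal.summable_toReal hθ1.ne
  refine this.congr fun j => ?_
  simp only [F]
  rw [ENNReal.toReal_mul, ENNReal.toReal_ofReal (hε j), ENNReal.toReal_ofReal (abs_nonneg _)]

lemma mp_cons {n d : ℕ} (c : (Fin (n+1) → Fin d) → ℂ) (t : ℂ) (w : Fin n → ℂ) :
    mp c (Fin.cons t w) = mp (fun b => ∑ α : Fin d, c (Fin.cons α b) * t ^ (α : ℕ)) w := by
  unfold mp
  rw [← (Fin.consEquiv (fun _ : Fin (n+1) => Fin d)).sum_comp, Fintype.sum_prod_type, Finset.sum_comm]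
  refine Finset.sum_congr rfl fun b _ => ?_
  rw [Finset.sum_mul]
  refine Finset.sum_congr rfl fun α _ => ?_
  simp [Fin.consEquiv, Fin.prod_univ_succ, mul_assoc]

lemma mahler_multi (n : ℕ) : ∀ (d : ℕ → ℕ) (c : ∀ j, (Fin n → Fin (d j)) → ℂ) (ε : ℕ → ℝ), (∀ j, 0 ≤ ε j) →
    (Summable fun j => ε j * d j) → ∀ C : ℝ, 0 ≤ C → (∀ j a, ‖c j a‖ ≤ Real.exp (C * d j)) →
    ∀ a : ∀ j, (Fin n → Fin (d j)), (∀ j, c j (a j) ≠ 0) → (Summable fun j => ε j * |Real.log ‖c j (a j)‖|) →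
    ∃ z : Fin n → ℂ, (∀ j, mp (c j) z ≠ 0) ∧ Summable fun j => ε j * |Real.log ‖mp (c j) z‖| := by
  induction n with
  | zero =>
    intro d c ε _ _ C _ _ a ha hs
    have : ∀ j z, mp (c j) z = c j (a j) := by
      intro j z
      simp only [mp, Finset.univ_eq_empty, Finset.prod_empty, mul_one]
      rw [Fintype.sum_eq_single (a j) (fun b hb => absurd (Subsingleton.elim _ _) hb)]
    refine ⟨0, ?_, ?_⟩
    · simpa only [this] using ha
    · simpa only [this] using hs
  | succ n ih =>
    intro d c ε hε hεd C hC hc a ha hs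
    let Q : ∀ j, (Fin n → Fin (d j)) → ℂ[X] := fun j b => ∑ α : Fin (d j), Polynomial.monomial (α : ℕ) (c j (Fin.cons α b))
    have hQe : ∀ j b t, (Q j b).eval t = ∑ α : Fin (d j), c j (Fin.cons α b) * t ^ (α : ℕ) := by
      intro j b t
      simp only [Q, eval_finsetSum, eval_monomial]
    have hQb : ∀ j b t, ‖t‖ = 1 → ‖(Q j b).eval t‖ ≤ Real.exp ((C + 1) * d j) := by
      intro j b t ht
      rw [hQe]
      calc _ ≤ ∑ α : Fin (d j), ‖c j (Fin.cons α b) * t ^ (α : ℕ)‖ := norm_sum_le _ _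
        _ ≤ ∑ α : Fin (d j), Real.exp (C * d j) := by
          refine Finset.sum_le_sum fun α _ => ?_
          rw [norm_mul, norm_pow, ht, one_pow, mul_one]
          exact hc _ _
        _ = d j * Real.exp (C * d j) := by simp
        _ ≤ Real.exp (d j) * Real.exp (C * d j) := by
          gcongr
          linarith [Real.add_one_le_exp (d j : ℝ)]
        _ = _ := by rw [← Real.exp_add]; congr 1; ring
    have hQd : ∀ j b, (Q j b).natDegree ≤ d j := by
      intro j b
      refine natDegree_sum_le_of_forall_le _ _ fun α _ => ?_
      exact (natDegree_monomial_le _).trans α.2.le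
    have hQc : ∀ j b (α : Fin (d j)), (Q j b).coeff α = c j (Fin.cons α b) := by
      intro j b α
      simp only [Q, finsetSum_coeff, coeff_monomial]
      rw [Finset.sum_eq_single α]
      · simp
      · intro β _ hβ
        rw [if_neg]
        intro h; exact hβ (Fin.ext h)
      · simp
    have hcons : ∀ j, c j (Fin.cons (a j 0) (Fin.tail (a j))) = c j (a j) := by
      intro j; rw [Fin.cons_self_tail]
    obtain ⟨t, ht, ht0, hts⟩ := mahler_step (fun j => Q j (Fin.tail (a j))) d ε hε hεd (C := C + 1) (by linarith)
      (fun j => hQd j _) (fun j => hQb j _) (fun j => a j 0) (fun j => by rw [hQc, hcons]; exact ha j)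
      (by simpa only [hQc, hcons] using hs)
    obtain ⟨w, hw, hws⟩ := ih d (fun j b => (Q j b).eval t) ε hε hεd (C + 1) (by linarith)
      (fun j b => hQb j b t ht) (fun j => Fin.tail (a j)) ht0 hts
    have key : ∀ j, mp (c j) (Fin.cons t w) = mp (fun b => (Q j b).eval t) w := by
      intro j
      rw [mp_cons]
      simp only [hQe]
    refine ⟨Fin.cons t w, ?_, ?_⟩
    · simpa only [key] using hw
    · simpa only [key] using hws

end Mahler

section PP

lemma max_prod (f : ℕ → ℂ → ℂ) (hf : ∀ j, Differentiable ℂ (f j)) (k : ℕ → ℕ) (hk : ∀ j, 1 ≤ k j) (J : ℕ)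
    (q : ℂ[X]) {c : ℂ} {r : ℝ} (hr : 0 < r)
    (hs : ∀ t ∈ sphere c r, ∏ j ∈ Finset.range J, ‖f j t‖ ^ ((k j : ℝ)⁻¹) ≤ Real.exp (q.eval t).re) :
    ∀ t ∈ closedBall c r, ∏ j ∈ Finset.range J, ‖f j t‖ ^ ((k j : ℝ)⁻¹) ≤ Real.exp (q.eval t).re := by
  set K : ℕ := ∏ j ∈ Finset.range J, k j with hK
  have hKpos : 0 < K := Finset.prod_pos fun j _ => hk j
  let Q : ℂ → ℂ := fun t => (∏ j ∈ Finset.range J, f j t ^ (∏ i ∈ (Finset.range J).erase j, k i)) *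
    Complex.exp (-(K * q.eval t))
  have hQd : Differentiable ℂ Q := by
    have h1 : Differentiable ℂ fun t => ∏ j ∈ Finset.range J, f j t ^ (∏ i ∈ (Finset.range J).erase j, k i) := by
      refine Differentiable.fun_finsetProd fun j _ => ?_
      exact (hf j).pow _
    have h2 : Differentiable ℂ fun t => Complex.exp (-(K * q.eval t)) := by
      have := q.differentiable
      fun_prop
    exact h1.mul h2
  have hQn : ∀ t, ‖Q t‖ = (∏ j ∈ Finset.range J, ‖f j t‖ ^ ((k j : ℝ)⁻¹)) ^ K / Real.exp (q.eval t).re ^ K := by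
    intro t
    simp only [Q]
    rw [norm_mul, Complex.norm_exp, norm_prod, ← Finset.prod_pow, ← Real.exp_nat_mul, div_eq_mul_inv, ← Real.exp_neg]
    congr 1
    · refine Finset.prod_congr rfl fun j hj => ?_
      have hkj : (k j : ℝ) ≠ 0 := by have := hk j; positivity
      rw [norm_pow, hK, ← Finset.mul_prod_erase _ _ hj, pow_mul, ← Real.rpow_natCast (‖f j t‖ ^ ((k j : ℝ)⁻¹)) (k j),
        ← Real.rpow_mul (norm_nonneg _), inv_mul_cancel₀ hkj, Real.rpow_one]
    · congr 1
      simp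
  have hpn : ∀ t, 0 ≤ ∏ j ∈ Finset.range J, ‖f j t‖ ^ ((k j : ℝ)⁻¹) := fun t =>
    Finset.prod_nonneg fun j _ => by positivity
  have hQs : ∀ t ∈ sphere c r, ‖Q t‖ ≤ 1 := by
    intro t ht
    rw [hQn, div_le_one (by positivity)]
    exact pow_le_pow_left₀ (hpn t) (hs t ht) K
  intro t ht
  have h1 : ‖Q t‖ ≤ 1 := by
    refine Complex.norm_le_of_forall_mem_frontier_norm_le (U := ball c r) isBounded_ball hQd.diffContOnCl ?_ ?_
    · rw [frontier_ball _ hr.ne']; exact hQs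
    · rw [closure_ball _ hr.ne']; exact ht
  rw [hQn, div_le_one (by positivity)] at h1
  exact le_of_pow_le_pow_left₀ hKpos.ne' (by positivity) h1

lemma psh_of_seq {n : ℕ} (w : ℕ → (Fin n → ℂ) → ℝ) (hc : ∀ J, Continuous (w J))
    (hanti : ∀ z, Antitone fun J => w J z) (τ : ℕ → ℝ) (hτ : Filter.Tendsto τ Filter.atTop (𝓝 0))
    (hmax : ∀ (a b : Fin n → ℂ) (c : ℂ) (r : ℝ), 0 < r → ∃ M : ℝ, ∀ (J : ℕ) (q : ℂ[X]),
      (∀ t ∈ sphere c r, w J (a + t • b) ≤ Real.exp (q.eval t).re) →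
      ∀ t ∈ closedBall c r, w J (a + t • b) ≤ Real.exp ((q.eval t).re + τ J * M)) :
    Plurisubharmonic (fun z => ENNReal.log (⨅ J, ENNReal.ofReal (w J z))) := by
  have husc : UpperSemicontinuous (fun z => ENNReal.log (⨅ J, ENNReal.ofReal (w J z))) := by
    refine ENNReal.continuous_log.comp_upperSemicontinuous (upperSemicontinuous_iInf fun J => ?_) ENNReal.log_monotone
    exact (ENNReal.continuous_ofReal.comp (hc J)).upperSemicontinuous
  have hle : ∀ z (x : ℝ), ENNReal.log (⨅ J, ENNReal.ofReal (w J z)) ≤ (x : EReal) ↔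
      (⨅ J, ENNReal.ofReal (w J z)) ≤ ENNReal.ofReal (Real.exp x) := by
    intro z x
    rw [← ENNReal.log_le_log_iff, ENNReal.log_ofReal_of_pos (Real.exp_pos x), Real.log_exp]
  refine ⟨husc, ?_, ?_⟩
  · intro z h
    rw [ENNReal.log_eq_top_iff, iInf_eq_top] at h
    exact ENNReal.ofReal_ne_top (h 0)
  intro a b
  have hcl : Continuous fun t : ℂ => a + t • b := by fun_prop
  refine ⟨(husc.comp hcl).upperSemicontinuousOn _, ?_⟩
  intro c r hr _ q hq t ht
  simp only [hle] at hq ⊢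
  obtain ⟨M, hM⟩ := hmax a b c r hr
  -- it suffices to have the estimate up to a small error
  have key : ∀ ε : ℝ, 0 < ε → (⨅ J, ENNReal.ofReal (w J (a + t • b))) ≤ ENNReal.ofReal (Real.exp ((q.eval t).re + 2 * ε)) := by
    intro ε hε
    have hcov : ∃ J0, ∀ J, J0 ≤ J → ∀ s ∈ sphere c r, w J (a + s • b) ≤ Real.exp ((q.eval s).re + ε) := by
      let U : ℕ → Set ℂ := fun J => {s | w J (a + s • b) < Real.exp ((q.eval s).re + ε)}
      have hUo : ∀ J, IsOpen (U J) := by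
        intro J
        refine isOpen_lt ((hc J).comp hcl) ?_
        have := q.continuous
        fun_prop
      have hUm : Monotone U := fun J J' h s hs => lt_of_le_of_lt (hanti _ h) hs
      obtain ⟨J0, hJ0⟩ := (isCompact_sphere c r).elim_directed_cover U hUo (by
        intro s hs
        have h1 := hq s hs
        have h2 : (⨅ J, ENNReal.ofReal (w J (a + s • b))) < ENNReal.ofReal (Real.exp ((q.eval s).re + ε)) :=
          h1.trans_lt ((ENNReal.ofReal_lt_ofReal_iff (Real.exp_pos _)).2 (Real.exp_lt_exp.2 (by linarith)))
        obtain ⟨J, hJ⟩ := iInf_lt_iff.1 h2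
        exact mem_iUnion.2 ⟨J, (ENNReal.ofReal_lt_ofReal_iff (Real.exp_pos _)).1 hJ⟩) hUm.directed_le
      exact ⟨J0, fun J hJ s hs => (hUm hJ (hJ0 hs)).le⟩
    obtain ⟨J0, hJ0⟩ := hcov
    have hτM : Filter.Tendsto (fun J => τ J * M) Filter.atTop (𝓝 0) := by simpa using hτ.mul_const M
    obtain ⟨J, hJ1, hJ2⟩ := ((hτM.eventually (gt_mem_nhds hε)).and (Filter.eventually_ge_atTop J0)).exists
    have hre : ∀ s, (q.eval s).re + ε = ((q + Polynomial.C (ε : ℂ)).eval s).re := by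
      intro s; simp
    have := hM J (q + Polynomial.C (ε : ℂ)) (fun s hs => by rw [← hre]; exact hJ0 J hJ2 s hs) t ht
    rw [← hre] at this
    refine (iInf_le _ J).trans (ENNReal.ofReal_le_ofReal (this.trans (Real.exp_le_exp.2 ?_)))
    linarith
  have hlim : Filter.Tendsto (fun ε : ℝ => ENNReal.ofReal (Real.exp ((q.eval t).re + 2 * ε))) (𝓝[>] 0)
      (𝓝 (ENNReal.ofReal (Real.exp (q.eval t).re))) := by
    have : Continuous (fun ε : ℝ => ENNReal.ofReal (Real.exp ((q.eval t).re + 2 * ε))) :=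
      ENNReal.continuous_ofReal.comp (by fun_prop)
    have h := this.tendsto 0
    simp only [mul_zero, add_zero] at h
    exact h.mono_left nhdsWithin_le_nhds
  exact ge_of_tendsto hlim (Filter.eventually_of_mem self_mem_nhdsWithin fun ε hε => key ε hε)

lemma pluripolar_iUnion {n : ℕ} (S : ℕ → Set (Fin n → ℂ)) (hS : ∀ i, PolySmall (S i)) : Pluripolar (⋃ i, S i) := by
  have hch : ∀ j : ℕ, ∃ d : ℕ, 1 ≤ d ∧ ∃ c : (Fin n → Fin d) → ℂ, (∀ a, ‖c a‖ ≤ 1) ∧ (∃ a, ‖c a‖ = 1) ∧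
    ∀ z ∈ S (Nat.unpair j).1, ‖mp c z‖ ≤ Real.exp (-((((2:ℝ) ^ j) * (j + 1)) * d)) := fun j => hS _ _
  choose d hd c hc1 hc2 hcS using hch
  choose α hα using hc2
  set k : ℕ → ℕ := fun j => 2 ^ j * d j with hk
  have hk1 : ∀ j, 1 ≤ k j := fun j => Nat.mul_pos (by positivity) (hd j)
  have hdk : ∀ j, (k j : ℝ)⁻¹ * d j = (1/2) ^ j := by
    intro j
    have : (d j : ℝ) ≠ 0 := by have := hd j; positivity
    simp only [hk]; push_cast
    field_simp
    rw [one_div, inv_pow, mul_inv_cancel₀ (by positivity)]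
  set ell : (Fin n → ℂ) → ℝ := fun z => n * Real.log (2 * (1 + ‖z‖)) with hell
  have hell0 : ∀ z, 0 ≤ ell z := fun z => mul_nonneg (by positivity) (Real.log_nonneg (by linarith [norm_nonneg z]))
  have hellc : Continuous ell := by
    refine continuous_const.mul (Continuous.log (by fun_prop) fun z => ?_)
    positivity
  have hp : ∀ j z, ‖mp (c j) z‖ ^ ((k j : ℝ)⁻¹) ≤ Real.exp ((1/2) ^ j * ell z) := by
    intro j z
    have h1 := norm_mp_le (c j) (hc1 j) z (R := 1 + ‖z‖) (by linarith [norm_nonneg z]) (by linarith)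
    have h2 : (2 * (1 + ‖z‖)) ^ (n * d j) = Real.exp (d j * ell z) := by
      have hpos : 0 < 2 * (1 + ‖z‖) := by positivity
      simp only [hell]
      rw [← Real.exp_log (pow_pos hpos _), Real.log_pow]
      congr 1; push_cast; ring
    rw [h2] at h1
    calc _ ≤ (Real.exp (d j * ell z)) ^ ((k j : ℝ)⁻¹) := by gcongr
      _ = _ := by
        rw [← Real.exp_mul, ← hdk]; congr 1; ring
  set F : ℕ → (Fin n → ℂ) → ℝ := fun J z => ∏ j ∈ Finset.range J, ‖mp (c j) z‖ ^ ((k j : ℝ)⁻¹) with hF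
  have hF0 : ∀ J z, 0 ≤ F J z := fun J z => Finset.prod_nonneg fun j _ => by positivity
  set τ : ℕ → ℝ := fun J => 2 * (1/2) ^ J with hτ
  set w : ℕ → (Fin n → ℂ) → ℝ := fun J z => F J z * Real.exp (τ J * ell z) with hw
  have hw0 : ∀ J z, 0 ≤ w J z := fun J z => mul_nonneg (hF0 J z) (Real.exp_pos _).le
  have hstep : ∀ J z, w (J+1) z = w J z * (‖mp (c J) z‖ ^ ((k J : ℝ)⁻¹) * Real.exp (-((1/2) ^ J * ell z))) := by
    intro J z
    simp only [hw, hF, hτ, Finset.prod_range_succ]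
    have : Real.exp (2 * (1/2:ℝ) ^ (J+1) * ell z) = Real.exp (2 * (1/2:ℝ) ^ J * ell z) * Real.exp (-((1/2) ^ J * ell z)) := by
      rw [← Real.exp_add]; congr 1; ring
    rw [this]; ring
  have hanti : ∀ z, Antitone fun J => w J z := by
    intro z
    refine antitone_nat_of_succ_le fun J => ?_
    rw [hstep]
    refine mul_le_of_le_one_right (hw0 J z) ?_
    rw [Real.exp_neg, ← div_eq_mul_inv, div_le_one (Real.exp_pos _)]
    exact hp J z
  have hwc : ∀ J, Continuous (w J) := by
    intro J
    refine Continuous.mul (continuous_finsetProd _ fun j _ => ?_) (by fun_prop)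
    exact ((mp_differentiable (c j)).continuous.norm).rpow_const fun z => Or.inr (by positivity)
  have hτ0 : Filter.Tendsto τ Filter.atTop (𝓝 0) := by
    have := (tendsto_pow_atTop_nhds_zero_of_lt_one (r := (1/2:ℝ)) (by norm_num) (by norm_num)).const_mul 2
    rw [mul_zero] at this
    exact this
  have hτn : ∀ J, 0 ≤ τ J := fun J => by simp only [hτ]; positivity
  refine ⟨_, psh_of_seq w hwc hanti τ hτ0 ?_, ?_, ?_⟩
  · intro a b e r hr
    have hcl : Continuous fun t : ℂ => a + t • b := by fun_prop
    obtain ⟨M, hM⟩ := (isCompact_closedBall e r).bddAbove_image (hellc.comp hcl).continuousOn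
    refine ⟨M, fun J q hq t ht => ?_⟩
    have h1 := max_prod (fun j t => mp (c j) (a + t • b)) (fun j => (mp_differentiable (c j)).comp (by fun_prop)) k hk1 J q hr
      (by
        intro s hs
        refine le_trans ?_ (hq s hs)
        exact le_mul_of_one_le_right (hF0 J _) (Real.one_le_exp (mul_nonneg (hτn J) (hell0 _)))) t ht
    have h2 : ell (a + t • b) ≤ M := hM ⟨t, ht, rfl⟩
    rw [Real.exp_add]
    exact mul_le_mul h1 (Real.exp_le_exp.2 (mul_le_mul_of_nonneg_left h2 (hτn J))) (Real.exp_pos _).le (Real.exp_pos _).le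
  · obtain ⟨z, hz0, hzs⟩ := mahler_multi n d c (fun j => (k j : ℝ)⁻¹) (fun j => by positivity)
      (by simp only [hdk]; exact summable_geometric_of_lt_one (by norm_num) (by norm_num)) 0 le_rfl
      (fun j a => by simpa using hc1 j a) α (fun j h => by have := hα j; rw [h] at this; simp at this)
      (by simp [hα])
    intro hbot
    have h := hbot z
    rw [ENNReal.log_eq_bot_iff] at h
    set T := ∑' j, (k j : ℝ)⁻¹ * |Real.log ‖mp (c j) z‖| with hT
    have hlow : ∀ J, Real.exp (-T) ≤ w J z := by
      intro J
      have h1 : Real.exp (-T) ≤ F J z := by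
        have h2 : F J z = Real.exp (∑ j ∈ Finset.range J, (k j : ℝ)⁻¹ * Real.log ‖mp (c j) z‖) := by
          rw [Real.exp_sum]
          refine Finset.prod_congr rfl fun j _ => ?_
          rw [Real.rpow_def_of_pos (norm_pos_iff.2 (hz0 j)), mul_comm]
        rw [h2]
        apply Real.exp_le_exp.2
        have h3 := hzs.sum_le_tsum (Finset.range J) (fun j _ => by positivity)
        have h4 : -(∑ j ∈ Finset.range J, (k j : ℝ)⁻¹ * |Real.log ‖mp (c j) z‖|) ≤
            ∑ j ∈ Finset.range J, (k j : ℝ)⁻¹ * Real.log ‖mp (c j) z‖ := by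
          rw [← Finset.sum_neg_distrib]
          refine Finset.sum_le_sum fun j _ => ?_
          rw [← mul_neg]
          exact mul_le_mul_of_nonneg_left (neg_abs_le _) (by positivity)
        linarith
      exact h1.trans (le_mul_of_one_le_right (hF0 J _) (Real.one_le_exp (mul_nonneg (hτn J) (hell0 _))))
    have h5 : ENNReal.ofReal (Real.exp (-T)) ≤ ⨅ J, ENNReal.ofReal (w J z) :=
      le_iInf fun J => ENNReal.ofReal_le_ofReal (hlow J)
    rw [h] at h5
    have := ENNReal.ofReal_pos.2 (Real.exp_pos (-T))
    exact absurd h5 (not_le.2 this)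
  · intro z hz
    obtain ⟨i, hi⟩ := mem_iUnion.1 hz
    rw [ENNReal.log_eq_bot_iff]
    have hsm : ∀ l : ℕ, (⨅ J, ENNReal.ofReal (w J z)) ≤ ENNReal.ofReal (w 0 z * Real.exp (-(l : ℝ))) := by
      intro l
      set j := Nat.pair i l with hj
      have hlj : l ≤ j := Nat.right_le_pair i l
      have h1 := hcS j z (by rw [hj, Nat.unpair_pair]; exact hi)
      have h2 : ‖mp (c j) z‖ ^ ((k j : ℝ)⁻¹) ≤ Real.exp (-(l : ℝ)) := by
        calc _ ≤ (Real.exp (-((((2:ℝ) ^ j) * (j + 1)) * d j))) ^ ((k j : ℝ)⁻¹) := by gcongr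
          _ = Real.exp (-((2:ℝ) ^ j * (j + 1) * ((k j : ℝ)⁻¹ * d j))) := by
            rw [← Real.exp_mul]; congr 1; ring
          _ = Real.exp (-((j:ℝ) + 1)) := by
            rw [hdk]; congr 2
            rw [one_div, inv_pow]; field_simp
          _ ≤ _ := by
            apply Real.exp_le_exp.2
            have : (l : ℝ) ≤ j := by exact_mod_cast hlj
            linarith
      refine (iInf_le _ (j+1)).trans (ENNReal.ofReal_le_ofReal ?_)
      rw [hstep]
      refine mul_le_mul (hanti z (Nat.zero_le j)) ?_ (by positivity) (hw0 0 z)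
      calc _ ≤ Real.exp (-(l : ℝ)) * 1 := by
            refine mul_le_mul h2 (Real.exp_le_one_iff.2 ?_) (by positivity) (by positivity)
            have := hell0 z
            have : 0 ≤ (1/2:ℝ) ^ j * ell z := by positivity
            linarith
        _ = _ := mul_one _
    have hlim : Filter.Tendsto (fun l : ℕ => ENNReal.ofReal (w 0 z * Real.exp (-(l : ℝ)))) Filter.atTop (𝓝 0) := by
      have h1 : Filter.Tendsto (fun l : ℕ => w 0 z * Real.exp (-(l : ℝ))) Filter.atTop (𝓝 0) := by
        have := (Real.tendsto_exp_neg_atTop_nhds_zero.comp tendsto_natCast_atTop_atTop).const_mul (w 0 z)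
        simpa using this
      simpa using ENNReal.tendsto_ofReal h1
    exact le_antisymm (ge_of_tendsto' hlim hsm) bot_le

lemma Pluripolar.mono {n : ℕ} {A B : Set (Fin n → ℂ)} (h : A ⊆ B) (hB : Pluripolar B) : Pluripolar A := by
  obtain ⟨u, h1, h2, h3⟩ := hB
  exact ⟨u, h1, h2, fun z hz => h3 z (h hz)⟩

end PP

section Final

lemma full_mult_coeff {m : ℕ} (hm : 2 ≤ m) (i0 i1 : Fin m) (hi0 : (i0 : ℕ) = 0) (hi1 : (i1 : ℕ) = 1) (b : Fin m → ℂ) (c : ℂ)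
    (h : ∀ w : ℂ, w ^ m + ∑ i : Fin m, b i * w ^ (m - ((i : ℕ) + 1)) = (w - c) ^ m) :
    b i1 - (((m : ℂ) - 1) / (2 * (m : ℂ))) * (b i0) ^ 2 = 0 := by
  have hP : (X ^ m + ∑ i : Fin m, Polynomial.C (b i) * X ^ (m - ((i : ℕ) + 1)) : ℂ[X]) = (X - Polynomial.C c) ^ m := by
    refine Polynomial.funext fun w => ?_
    simpa [eval_finsetSum] using h w
  rw [sub_eq_add_neg, ← Polynomial.C_neg] at hP
  have hco : ∀ i0 : Fin m, b i0 = (-c) ^ ((i0 : ℕ) + 1) * (m.choose ((i0 : ℕ) + 1) : ℕ) := by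
    intro i0
    have h1 := congrArg (fun p : ℂ[X] => p.coeff (m - ((i0 : ℕ) + 1))) hP
    simp only [coeff_add, finsetSum_coeff, coeff_C_mul, coeff_X_pow, coeff_X_add_C_pow] at h1
    have hi := i0.2
    rw [if_neg (by omega), Finset.sum_eq_single i0, if_pos rfl, Nat.choose_symm (by omega),
      show m - (m - ((i0 : ℕ) + 1)) = (i0 : ℕ) + 1 by omega] at h1
    · simpa using h1
    · intro i _ hne
      rw [if_neg, mul_zero]
      intro hh
      have := i.2
      exact hne (Fin.ext (by omega))
    · simp
  have h0 := hco i0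
  have h1 := hco i1
  rw [h0, h1, hi0, hi1]
  have hm0 : (m : ℂ) ≠ 0 := by
    have : m ≠ 0 := by omega
    exact_mod_cast this
  simp only [zero_add, pow_one, Nat.choose_one_right]
  rw [show 1 + 1 = 2 from rfl, Nat.cast_choose_two]
  field_simp
  ring

lemma pluripolar_zero {n : ℕ} {D : Set (Fin n → ℂ)} (hD : IsOpen D) {h : (Fin n → ℂ) → ℂ} (hf : LineHol h D)
    (hne : ∀ x ∈ D, ¬ ∀ᶠ y in 𝓝 x, h y = 0) : Pluripolar {z ∈ D | h z = 0} := by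
  obtain ⟨S, hSc, hS, hcov⟩ := strat hD hf hne PolySmall PolySmall.mono (by
    intro g hg z hz v hgz hv
    cases n with
    | zero =>
      exfalso
      apply hv
      have : v = 0 := Subsingleton.elim _ _
      simp [dirD, this]
    | succ k => exact small_graph hD hg hz hgz hv)
  rcases S.eq_empty_or_nonempty with rfl | hne'
  · refine ⟨fun _ => 0, ⟨upperSemicontinuous_const, fun _ => by simp, fun a b => ?_⟩, by simp, fun z hz => ?_⟩
    · refine ⟨upperSemicontinuousOn_const, ?_⟩
      intro c r hr _ p hp z hz
      have h1 := max_prod (fun _ _ => 1) (fun _ => differentiable_const _) (fun _ => 1) (fun _ => le_rfl) 0 p hr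
        (by
          intro t ht
          have h0 : (0 : EReal) ≤ (((p.eval t).re : ℝ) : EReal) := hp t ht
          have : 0 ≤ (p.eval t).re := EReal.coe_nonneg.1 h0
          simpa using this) z hz
      have : 0 ≤ (p.eval z).re := by simpa using h1
      exact EReal.coe_nonneg.2 this
    · have := hcov hz
      simp at this
  · obtain ⟨e, he⟩ := hSc.exists_eq_range hne'
    refine (pluripolar_iUnion e fun i => hS _ (he ▸ mem_range_self i)).mono ?_
    rw [he, sUnion_range] at hcov
    exact hcov

end Final


/-- If `a₁, …, a_m` are holomorphic off the set `B` of points where `P(z,·)` has a root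
of multiplicity `m`, and `B` is not pluripolar, then `a₂ = ((m-1)/(2m))·a₁²` on `D`. -/
theorem a2_eq_of_nonpluripolar_full_multiplicity_set
    {n m : ℕ} (hm : 2 ≤ m) (D : Set (Fin n → ℂ))
    (hDopen : IsOpen D) (hDconn : IsConnected D)
    (a : Fin m → (Fin n → ℂ) → ℂ) (ha : ∀ i, ContinuousOn (a i) D)
    (B : Set (Fin n → ℂ))
    (hB : B = {z | z ∈ D ∧ ∃ c : ℂ, ∀ w : ℂ,
      w ^ m + ∑ i : Fin m, a i z * w ^ (m - ((i : ℕ) + 1)) = (w - c) ^ m})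
    (hhol : ∀ i, DifferentiableOn ℂ (a i) (D \ B))
    (hBnp : ¬ Pluripolar B) :
    ∀ z ∈ D, a ⟨1, by omega⟩ z =
      (((m : ℂ) - 1) / (2 * (m : ℂ))) * (a ⟨0, by omega⟩ z) ^ 2 := by
  have hh : ∀ z ∈ D, a ⟨1, by omega⟩ z - (((m : ℂ) - 1) / (2 * (m : ℂ))) * (a ⟨0, by omega⟩ z) ^ 2 = 0 := by
    set h : (Fin n → ℂ) → ℂ := fun z =>
      a ⟨1, by omega⟩ z - (((m : ℂ) - 1) / (2 * (m : ℂ))) * (a ⟨0, by omega⟩ z) ^ 2 with hh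
    have hB0 : ∀ z ∈ B, h z = 0 := by
      intro z hz
      rw [hB] at hz
      obtain ⟨_, c, hc⟩ := hz
      exact full_mult_coeff hm _ _ rfl rfl (fun i => a i z) c hc
    have hcont : ContinuousOn h D := (ha _).sub (continuousOn_const.mul ((ha _).pow 2))
    have hdiff : ∀ z ∈ D, h z ≠ 0 → DifferentiableAt ℂ h z := by
      intro z hz hz0
      have hnb : D \ B ∈ 𝓝 z := by
        have h1 : ∀ᶠ y in 𝓝 z, h y ≠ 0 := (hcont.continuousAt (hDopen.mem_nhds hz)).eventually_ne hz0
        filter_upwards [h1, hDopen.mem_nhds hz] with y hy hyD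
        exact ⟨hyD, fun hyB => hy (hB0 y hyB)⟩
      have hd : ∀ i, DifferentiableAt ℂ (a i) z := fun i => (hhol i).differentiableAt hnb
      exact (hd _).sub (((hd _).pow 2).const_mul _)
    have hline : LineHol h D := by
      refine ⟨hcont, fun x v => ?_⟩
      refine rado (isOpen_slice hDopen x v) (hcont.comp (by fun_prop) fun t ht => ht) ?_
      intro t ht ht0
      have h1 : DifferentiableAt ℂ (fun t : ℂ => x + t • v) t := by fun_prop
      exact DifferentiableAt.comp (g := h) (f := fun t : ℂ => x + t • v) t (hdiff _ ht ht0) h1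
    by_cases hne : ∀ x ∈ D, ¬ ∀ᶠ y in 𝓝 x, h y = 0
    · exact absurd (Pluripolar.mono (A := B) (B := {z ∈ D | h z = 0}) (fun z hz =>
        ⟨by rw [hB] at hz; exact hz.1, hB0 z hz⟩) (pluripolar_zero hDopen hline hne)) hBnp
    · push Not at hne
      obtain ⟨x, hx, hx0⟩ := hne
      exact zero_of_eventually hDopen hDconn.isPreconnected hline hx hx0
  intro z hz
  exact sub_eq_zero.1 (hh z hz)
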